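/- Let X be a metric space, U and V open subsets of X, and k ≥ 0. Identifying, for each open W ⊆ X, the group N_k^c(W) with its image in N_k^c(X) under the (injective) push-forward of the inclusion W → X, the sequence 0 → N_k^c(U ∩ V) → N_k^c(U) ⊕ N_k^c(V) → N_k^c(U ∪ V) → 0 is exact, where the first map is T ↦ (−T, T) and the second is (S, S') ↦ S + S'. -/

import Mathlib

open MeasureTheory Metric Set Filter

noncomputable section

/-- `f : X → ℝ` is Lipschitz. -/
def IsLip {X : Type*} [PseudoMetricSpace X] (f : X → ℝ) : Prop :=
  ∃ K : NNReal, LipschitzWith K f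

/-- `f : X → ℝ` is bounded and Lipschitz, i.e. `f ∈ Lip_b(X)`. -/
def IsLipBdd {X : Type*} [PseudoMetricSpace X] (f : X → ℝ) : Prop :=
  IsLip f ∧ ∃ C : ℝ, ∀ x, |f x| ≤ C

/-- The Lipschitz constant of a map. -/
def lipConst {X Y : Type*} [PseudoMetricSpace X] [PseudoMetricSpace Y] (f : X → Y) : NNReal :=
  sInf {K : NNReal | LipschitzWith K f}

/-- The type carrying (k+1)-multilinear functionals on `D^k(X) = Lip_b(X) × Lip(X)^k`;
a functional is recorded by its values `T f π`. -/
abbrev Func (X : Type*) (k : ℕ) : Type _ := (X → ℝ) → (Fin k → X → ℝ) → ℝ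

/-- `(f, π) ∈ D^k(X)`. -/
def InDomain {X : Type*} [PseudoMetricSpace X] {k : ℕ} (f : X → ℝ) (π : Fin k → X → ℝ) : Prop :=
  IsLipBdd f ∧ ∀ i, IsLip (π i)

/-- Two functionals agree as functionals on `D^k(X)`. -/
def DkEq {X : Type*} [PseudoMetricSpace X] {k : ℕ} (T T' : Func X k) : Prop :=
  ∀ f π, InDomain f π → T f π = T' f π

/-- `T` is multilinear on `D^k(X)`: linear in the `Lip_b`-argument and in each
`Lip`-argument. -/
def IsMultilinear {X : Type*} [PseudoMetricSpace X] {k : ℕ} (T : Func X k) : Prop :=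
  (∀ f g π, IsLipBdd f → IsLipBdd g → (∀ i, IsLip (π i)) → T (f + g) π = T f π + T g π) ∧
  (∀ (c : ℝ) f π, IsLipBdd f → (∀ i, IsLip (π i)) → T (c • f) π = c * T f π) ∧
  (∀ f π (i : Fin k) g g', IsLipBdd f → (∀ j, IsLip (π j)) → IsLip g → IsLip g' →
    T f (Function.update π i (g + g')) =
      T f (Function.update π i g) + T f (Function.update π i g')) ∧
  (∀ f π (i : Fin k) (c : ℝ) g, IsLipBdd f → (∀ j, IsLip (π j)) → IsLip g →
    T f (Function.update π i (c • g)) = c * T f (Function.update π i g))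

/-- A measure is tight if sets of small measure can be found outside compact sets. -/
def IsTightMeasure {X : Type*} [TopologicalSpace X] [MeasurableSpace X] (μ : Measure X) : Prop :=
  ∀ ε : ENNReal, 0 < ε → ∃ K : Set X, IsCompact K ∧ μ Kᶜ < ε

/-- The mass inequality `|T(f,π)| ≤ ∏ Lip(π_i) ∫ |f| dμ` for all `(f,π) ∈ D^k(X)`. -/
def MassBound {X : Type*} [PseudoMetricSpace X] [MeasurableSpace X] {k : ℕ}
    (T : Func X k) (μ : Measure X) : Prop :=
  ∀ f π, InDomain f π → |T f π| ≤ (∏ i, (lipConst (π i) : ℝ)) * ∫ x, |f x| ∂μ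

/-- The finite mass axiom: some finite *tight* Borel measure dominates `T`. -/
def HasFiniteMass {X : Type*} [PseudoMetricSpace X] [MeasurableSpace X] {k : ℕ}
    (T : Func X k) : Prop :=
  ∃ μ : Measure X, IsFiniteMeasure μ ∧ IsTightMeasure μ ∧ MassBound T μ

/-- `T ∈ D_k(X)`: a multilinear functional on `D^k(X)` with finite mass. -/
def MemDk {X : Type*} [PseudoMetricSpace X] [MeasurableSpace X] {k : ℕ} (T : Func X k) : Prop :=
  IsMultilinear T ∧ HasFiniteMass T

/-- The mass measure `‖T‖`: the minimal finite Borel measure satisfying the mass bound. -/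
def massMeasure {X : Type*} [PseudoMetricSpace X] [MeasurableSpace X] {k : ℕ}
    (T : Func X k) : Measure X :=
  sInf {μ : Measure X | IsFiniteMeasure μ ∧ MassBound T μ}

/-- The support of a measure: points all of whose balls have positive measure. -/
def msupport {X : Type*} [PseudoMetricSpace X] [MeasurableSpace X] (μ : Measure X) : Set X :=
  {x | ∀ r : ℝ, 0 < r → 0 < μ (Metric.ball x r)}

/-- Push-forward of a functional along `φ`. -/
def pushF {X Y : Type*} {k : ℕ} (φ : X → Y) (T : Func X k) : Func Y k :=
  fun f π => T (f ∘ φ) (fun i => π i ∘ φ)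

/-- Restriction `T⌊B` of a functional to a set `B`. -/
def restrF {X : Type*} {k : ℕ} (T : Func X k) (B : Set X) : Func X k :=
  fun f π => T (B.indicator f) π

/-- Locality: `T(f,π) = 0` if some `π_i` is constant on `{f ≠ 0}`. -/
def SatisfiesLocality {X : Type*} [PseudoMetricSpace X] {k : ℕ} (T : Func X k) : Prop :=
  ∀ f π, InDomain f π →
    (∃ i : Fin k, ∀ x ∈ {y | f y ≠ 0}, ∀ x' ∈ {y | f y ≠ 0}, π i x = π i x') → T f π = 0

/-- Continuity: `T(f,π^j) → T(f,π)` if `π_i^j → π_i` pointwise with uniformly bounded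
Lipschitz constants. -/
def SatisfiesContinuity {X : Type*} [PseudoMetricSpace X] {k : ℕ} (T : Func X k) : Prop :=
  ∀ (f : X → ℝ) (πs : ℕ → Fin k → X → ℝ) (π : Fin k → X → ℝ), IsLipBdd f →
    (∃ K : NNReal, ∀ j i, LipschitzWith K (πs j i)) → (∀ i, IsLip (π i)) →
    (∀ i x, Tendsto (fun j => πs j i x) atTop (nhds (π i x))) →
    Tendsto (fun j => T f (πs j)) atTop (nhds (T f π))

/-- A `k`-current: an element of `D_k(X)` satisfying locality and continuity. -/
def IsCurrent {X : Type*} [PseudoMetricSpace X] [MeasurableSpace X] {k : ℕ}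
    (T : Func X k) : Prop :=
  IsMultilinear T ∧ HasFiniteMass T ∧ SatisfiesLocality T ∧ SatisfiesContinuity T

/-- The boundary `∂T (f, π) = T(1, f, π)`. -/
def bdry {X : Type*} {k : ℕ} (T : Func X (k+1)) : Func X k :=
  fun f π => T (fun _ => (1:ℝ)) (Fin.cons f π)

/-- Normality: `∂T` has finite mass (in degree `0` every functional is normal). -/
def IsNormal {X : Type*} [PseudoMetricSpace X] [MeasurableSpace X] :
    ∀ {k : ℕ}, Func X k → Prop
  | 0, _ => True
  | _ + 1, T => HasFiniteMass (bdry T)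

/-- `T ∈ N_k^c(X)`: a normal current with compact support. -/
def MemNkc {X : Type*} [PseudoMetricSpace X] [MeasurableSpace X] {k : ℕ}
    (T : Func X k) : Prop :=
  IsCurrent T ∧ IsNormal T ∧ IsCompact (msupport (massMeasure T))

/-- `T` belongs to the image of `N_k^c(W)` in `N_k^c(X)` under the push-forward of the
inclusion `W → X` (which is injective), i.e. `T` is identified with an element of
`N_k^c(W)`. -/
def InNkcOf {X : Type*} [MetricSpace X] [MeasurableSpace X] [BorelSpace X] {k : ℕ}
    (W : Set X) (T : Func X k) : Prop :=
  ∃ T' : Func W k, MemNkc T' ∧ DkEq (pushF (Subtype.val : W → X) T') T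


open MeasureTheory Metric Set Filter
noncomputable section

section LipBasics
variable {X : Type*} [PseudoMetricSpace X]

lemma isLip_iff {f : X → ℝ} : IsLip f ↔ ∃ C : ℝ, ∀ x y, |f x - f y| ≤ C * dist x y := by
  constructor
  · rintro ⟨K, hK⟩
    exact ⟨K, fun x y => by simpa [Real.dist_eq] using hK.dist_le_mul x y⟩
  · rintro ⟨C, hC⟩
    refine ⟨C.toNNReal, LipschitzWith.of_dist_le_mul fun x y => ?_⟩
    rw [Real.dist_eq]
    refine (hC x y).trans ?_
    gcongr
    exact Real.le_coe_toNNReal C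

lemma IsLip.continuous {f : X → ℝ} (h : IsLip f) : Continuous f := by
  obtain ⟨K, hK⟩ := h; exact hK.continuous

lemma isLip_const (c : ℝ) : IsLip (fun _ : X => c) := ⟨0, LipschitzWith.const c⟩

lemma IsLip.add {f g : X → ℝ} (hf : IsLip f) (hg : IsLip g) : IsLip (f + g) := by
  obtain ⟨K, hK⟩ := hf; obtain ⟨L, hL⟩ := hg
  exact ⟨K + L, hK.add hL⟩

lemma IsLip.sub {f g : X → ℝ} (hf : IsLip f) (hg : IsLip g) : IsLip (f - g) := by
  obtain ⟨K, hK⟩ := hf; obtain ⟨L, hL⟩ := hg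
  exact ⟨K + L, hK.sub hL⟩

lemma IsLip.smul {f : X → ℝ} (c : ℝ) (hf : IsLip f) : IsLip (c • f) := by
  obtain ⟨C, hC⟩ := isLip_iff.1 hf
  refine isLip_iff.2 ⟨|c| * C, fun x y => ?_⟩
  have : (c • f) x - (c • f) y = c * (f x - f y) := by simp [mul_sub]
  rw [this, abs_mul, mul_assoc]
  exact mul_le_mul_of_nonneg_left (hC x y) (abs_nonneg c)

lemma IsLip.comp {Y : Type*} [PseudoMetricSpace Y] {f : X → ℝ} (hf : IsLip f) {φ : Y → X}
    (hφ : LipschitzWith 1 φ) : IsLip (f ∘ φ) := by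
  obtain ⟨K, hK⟩ := hf
  exact ⟨K * 1, hK.comp hφ⟩

lemma IsLipBdd.comp {Y : Type*} [PseudoMetricSpace Y] {f : X → ℝ} (hf : IsLipBdd f) {φ : Y → X}
    (hφ : LipschitzWith 1 φ) : IsLipBdd (f ∘ φ) :=
  ⟨hf.1.comp hφ, by obtain ⟨C, hC⟩ := hf.2; exact ⟨C, fun x => hC _⟩⟩

lemma isLipBdd_const (c : ℝ) : IsLipBdd (fun _ : X => c) := ⟨isLip_const c, |c|, fun _ => le_rfl⟩

lemma IsLipBdd.add {f g : X → ℝ} (hf : IsLipBdd f) (hg : IsLipBdd g) : IsLipBdd (f + g) := by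
  obtain ⟨C, hC⟩ := hf.2; obtain ⟨D, hD⟩ := hg.2
  exact ⟨hf.1.add hg.1, C + D, fun x => (abs_add_le _ _).trans (add_le_add (hC x) (hD x))⟩

lemma IsLipBdd.smul {f : X → ℝ} (c : ℝ) (hf : IsLipBdd f) : IsLipBdd (c • f) := by
  obtain ⟨C, hC⟩ := hf.2
  refine ⟨hf.1.smul c, |c| * C, fun x => ?_⟩
  simp only [Pi.smul_apply, smul_eq_mul, abs_mul]
  exact mul_le_mul_of_nonneg_left (hC x) (abs_nonneg c)

lemma IsLipBdd.sub {f g : X → ℝ} (hf : IsLipBdd f) (hg : IsLipBdd g) : IsLipBdd (f - g) := by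
  have : f - g = f + (-1 : ℝ) • g := by ext x; simp [sub_eq_add_neg]
  rw [this]; exact hf.add (hg.smul _)

lemma IsLipBdd.mul {f g : X → ℝ} (hf : IsLipBdd f) (hg : IsLipBdd g) : IsLipBdd (f * g) := by
  obtain ⟨C, hC⟩ := hf.2; obtain ⟨D, hD⟩ := hg.2
  obtain ⟨K, hK⟩ := isLip_iff.1 hf.1; obtain ⟨L, hL⟩ := isLip_iff.1 hg.1
  refine ⟨isLip_iff.2 ⟨C * L + K * D, fun x y => ?_⟩, C * D, fun x => ?_⟩
  · have e : (f * g) x - (f * g) y = f x * (g x - g y) + (f x - f y) * g y := by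
      simp only [Pi.mul_apply]; ring
    rw [e]
    refine (abs_add_le _ _).trans ?_
    rw [abs_mul, abs_mul, add_mul]
    have h1 := mul_le_mul (hC x) (hL x y) (abs_nonneg _) ((abs_nonneg _).trans (hC x))
    have h2 := mul_le_mul (hK x y) (hD y) (abs_nonneg _) ((abs_nonneg _).trans (hK x y))
    linarith
  · rw [Pi.mul_apply, abs_mul]
    exact mul_le_mul (hC x) (hD x) (abs_nonneg _) ((abs_nonneg _).trans (hC x))

lemma lipConst_le {f : X → ℝ} {K : NNReal} (h : LipschitzWith K f) : lipConst f ≤ K :=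
  csInf_le (OrderBot.bddBelow _) h

lemma lipschitzWith_lipConst {f : X → ℝ} (h : IsLip f) : LipschitzWith (lipConst f) f := by
  refine LipschitzWith.of_dist_le_mul fun x y => ?_
  rcases eq_or_lt_of_le (dist_nonneg (x := x) (y := y)) with h0 | h0
  · obtain ⟨K, hK⟩ := h
    have := hK.dist_le_mul x y
    rw [← h0] at this ⊢
    simpa using this
  · rw [← div_le_iff₀ h0]
    have : (dist (f x) (f y) / dist x y).toNNReal ≤ lipConst f := by
      refine le_csInf h fun K hK => ?_
      rw [Real.toNNReal_le_iff_le_coe, div_le_iff₀ h0]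
      exact hK.dist_le_mul x y
    exact Real.toNNReal_le_iff_le_coe.1 this

/-- clipping to `[-ε, ε]` -/
def clip (ε t : ℝ) : ℝ := max (-ε) (min t ε)

lemma clip_lip (ε s t : ℝ) : |clip ε s - clip ε t| ≤ |s - t| := by
  unfold clip
  have h1 : |max (-ε) (min s ε) - max (-ε) (min t ε)| ≤ |min s ε - min t ε| := by
    rw [max_comm, max_comm (-ε)]
    exact abs_max_sub_max_le_abs _ _ _
  exact h1.trans ((abs_min_sub_min_le_max s ε t ε).trans (by simp))

lemma clip_abs_le {ε : ℝ} (hε : 0 ≤ ε) (t : ℝ) : |clip ε t| ≤ ε := by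
  unfold clip
  rw [abs_le]
  exact ⟨le_max_left _ _, max_le (by linarith) (min_le_right _ _)⟩

lemma clip_of_abs_le {ε t : ℝ} (h : |t| ≤ ε) : clip ε t = t := by
  unfold clip
  rw [abs_le] at h
  rw [min_eq_left h.2, max_eq_right h.1]

lemma IsLip.clip {f : X → ℝ} (hf : IsLip f) (ε : ℝ) : IsLip (fun x => clip ε (f x)) := by
  obtain ⟨C, hC⟩ := isLip_iff.1 hf
  exact isLip_iff.2 ⟨C, fun x y => (clip_lip _ _ _).trans (hC x y)⟩

lemma IsLip.clipBdd {f : X → ℝ} (hf : IsLip f) {ε : ℝ} (hε : 0 ≤ ε) :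
    IsLipBdd (fun x => _root_.clip ε (f x)) := ⟨hf.clip ε, ε, fun _ => clip_abs_le hε _⟩

lemma isLipBdd_integrable [MeasurableSpace X] [OpensMeasurableSpace X] {f : X → ℝ}
    (hf : IsLipBdd f) (μ : Measure X) [IsFiniteMeasure μ] : Integrable f μ := by
  obtain ⟨C, hC⟩ := hf.2
  exact Integrable.of_bound hf.1.continuous.aestronglyMeasurable C
    (Eventually.of_forall fun x => by simpa using hC x)

lemma isLipBdd_integrable_abs [MeasurableSpace X] [OpensMeasurableSpace X] {f : X → ℝ}
    (hf : IsLipBdd f) (μ : Measure X) [IsFiniteMeasure μ] : Integrable (fun x => |f x|) μ :=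
  (isLipBdd_integrable hf μ).abs

/-- Lipschitz approximations of the indicator of a closed set. -/
lemma exists_lip_approx (F : Set X) (hF : IsClosed F) :
    ∃ φ : ℕ → X → ℝ, (∀ n, IsLipBdd (φ n)) ∧ (∀ n x, 0 ≤ φ n x) ∧ (∀ n x, φ n x ≤ 1) ∧
      (∀ n, ∀ x ∈ F, φ n x = 1) ∧ ∀ x, Tendsto (fun n => φ n x) atTop
        (nhds (F.indicator (fun _ => (1 : ℝ)) x)) := by
  have hδ : ∀ n : ℕ, (0 : ℝ) < 1 / (n + 1) := fun n => Nat.one_div_pos_of_nat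
  refine ⟨fun n x => (thickenedIndicator (hδ n) F x : ℝ), fun n => ⟨⟨(1 / (n + 1 : ℝ)).toNNReal⁻¹, ?_⟩, 1, fun x => ?_⟩,
    fun n x => NNReal.coe_nonneg _, fun n x => ?_, fun n x hx => ?_, fun x => ?_⟩
  · have := lipschitzWith_thickenedIndicator (hδ n) F
    refine LipschitzWith.of_dist_le_mul fun x y => ?_
    have := this.dist_le_mul x y
    simpa [NNReal.dist_eq, Real.dist_eq] using this
  · rw [abs_of_nonneg (NNReal.coe_nonneg _)]
    exact_mod_cast thickenedIndicator_le_one (hδ n) F x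
  · exact_mod_cast thickenedIndicator_le_one (hδ n) F x
  · show ((thickenedIndicator (hδ n) F x : NNReal) : ℝ) = 1
    exact_mod_cast thickenedIndicator_one (hδ n) F hx
  · have := thickenedIndicator_tendsto_indicator_closure hδ
      tendsto_one_div_add_atTop_nhds_zero_nat F
    rw [tendsto_pi_nhds] at this
    have h2 := (NNReal.continuous_coe.tendsto _).comp (this x)
    rw [hF.closure_eq] at h2
    have e : F.indicator (fun _ => (1 : ℝ)) x
        = ((F.indicator (fun _ => (1 : NNReal)) x : NNReal) : ℝ) := by
      by_cases hx : x ∈ F <;> simp [hx]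
    rw [e]
    exact h2

end LipBasics
end

open MeasureTheory Metric Set Filter
noncomputable section
set_option linter.unusedSectionVars false

section Mass
variable {X : Type*} [PseudoMetricSpace X] [MeasurableSpace X] [BorelSpace X] {k : ℕ}

lemma lipProd_nonneg (π : Fin k → X → ℝ) : 0 ≤ ∏ i, (lipConst (π i) : ℝ) :=
  Finset.prod_nonneg fun _ _ => NNReal.coe_nonneg _

lemma massBound_of_approx {T : Func X k} {ρ : Measure X} [IsFiniteMeasure ρ]
    (h : ∀ ε : ENNReal, 0 < ε → ∃ l κ : Measure X, MassBound T l ∧ l ≤ ρ + κ ∧ κ univ ≤ ε) :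
    MassBound T ρ := by
  intro f π hd
  obtain ⟨M, hM⟩ := hd.1.2
  have hM0 : 0 ≤ |M| := abs_nonneg _
  have hC := lipProd_nonneg π
  set C := ∏ i, (lipConst (π i) : ℝ) with hCdef
  have key : ∀ ε : ℝ, 0 < ε → |T f π| ≤ C * ∫ x, |f x| ∂ρ + (C * |M|) * ε := by
    intro ε hε
    obtain ⟨l, κ, hl, hle, hκ⟩ := h (ENNReal.ofReal ε) (ENNReal.ofReal_pos.2 hε)
    haveI : IsFiniteMeasure κ := ⟨hκ.trans_lt ENNReal.ofReal_lt_top⟩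
    have h1 := hl f π hd
    have h2 : ∫ x, |f x| ∂l ≤ ∫ x, |f x| ∂(ρ + κ) :=
      integral_mono_measure hle (Eventually.of_forall fun x => abs_nonneg _)
        (isLipBdd_integrable_abs hd.1 _)
    rw [integral_add_measure (isLipBdd_integrable_abs hd.1 _) (isLipBdd_integrable_abs hd.1 _)]
      at h2
    have h3 : ∫ x, |f x| ∂κ ≤ |M| * ε := by
      have : ∫ x, |f x| ∂κ ≤ ∫ x, |M| ∂κ :=
        integral_mono (isLipBdd_integrable_abs hd.1 _) (integrable_const _)
          fun x => (hM x).trans (le_abs_self M)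
      refine this.trans ?_
      rw [integral_const, smul_eq_mul, mul_comm]
      gcongr
      exact ENNReal.toReal_le_of_le_ofReal hε.le hκ
    calc |T f π| ≤ C * ∫ x, |f x| ∂l := h1
      _ ≤ C * (∫ x, |f x| ∂ρ + |M| * ε) := by gcongr; linarith
      _ = _ := by ring
  refine le_of_forall_pos_le_add fun ε hε => ?_
  have hD : 0 ≤ C * |M| := mul_nonneg hC hM0
  refine (key (ε / (C * |M| + 1)) (by positivity)).trans ?_
  have : C * |M| * (ε / (C * |M| + 1)) ≤ ε := by
    rw [mul_div_assoc', div_le_iff₀ (by positivity)]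
    nlinarith
  linarith

lemma tendsto_integral_approx {F : Set X} (hF : IsClosed F) {φ : ℕ → X → ℝ}
    (h0 : ∀ n, IsLipBdd (φ n)) (h1 : ∀ n x, 0 ≤ φ n x) (h2 : ∀ n x, φ n x ≤ 1)
    (h3 : ∀ x, Tendsto (fun n => φ n x) atTop (nhds (F.indicator (fun _ => (1 : ℝ)) x)))
    {f : X → ℝ} (hf : IsLipBdd f) (μ : Measure X) [IsFiniteMeasure μ] :
    Tendsto (fun n => ∫ x, |(φ n * f) x| ∂μ) atTop (nhds (∫ x, |f x| ∂(μ.restrict F))) := by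
  rw [← integral_indicator hF.measurableSet]
  refine tendsto_integral_of_dominated_convergence (fun x => |f x|)
    (fun n => (isLipBdd_integrable_abs ((h0 n).mul hf) μ).aestronglyMeasurable)
    (isLipBdd_integrable_abs hf μ) (fun n => Eventually.of_forall fun x => ?_)
    (Eventually.of_forall fun x => ?_)
  · simp only [Pi.mul_apply, abs_mul, Real.norm_eq_abs, abs_abs]
    rw [abs_of_nonneg (h1 n x)]
    exact mul_le_of_le_one_left (abs_nonneg _) (h2 n x)
  · have := ((h3 x).abs).mul_const |f x|
    simp only [Pi.mul_apply, abs_mul]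
    convert this using 2
    by_cases hx : x ∈ F <;> simp [hx]

/-- Combination along a closed set. -/
lemma massBound_combine_closed {T : Func X k} (hT : IsMultilinear T) {μ ν : Measure X}
    [IsFiniteMeasure μ] [IsFiniteMeasure ν] (hμ : MassBound T μ) (hν : MassBound T ν)
    {F : Set X} (hF : IsClosed F) : MassBound T (μ.restrict F + ν.restrict Fᶜ) := by
  intro f π hd
  obtain ⟨φ, h0, h1, h2, -, h3⟩ := exists_lip_approx F hF
  have hC := lipProd_nonneg π
  have t1 := tendsto_integral_approx hF h0 h1 h2 h3 hd.1 μ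
  have t2 : Tendsto (fun n => ∫ x, |(((fun _ : X => (1:ℝ)) - φ n) * f : X → ℝ) x| ∂ν) atTop
      (nhds (∫ x, |f x| ∂(ν.restrict Fᶜ))) := by
    have t := (tendsto_integral_approx hF h0 h1 h2 h3 hd.1 ν).const_sub (∫ x, |f x| ∂ν)
    have e : ∫ x, |f x| ∂ν - ∫ x, |f x| ∂(ν.restrict F) = ∫ x, |f x| ∂(ν.restrict Fᶜ) := by
      rw [← integral_add_compl hF.measurableSet (isLipBdd_integrable_abs hd.1 ν)]; ring
    rw [e] at t
    refine t.congr fun n => ?_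
    rw [← integral_sub (isLipBdd_integrable_abs hd.1 ν)
      (isLipBdd_integrable_abs ((h0 n).mul hd.1) ν)]
    refine integral_congr_ae (Eventually.of_forall fun x => ?_)
    simp only [Pi.mul_apply, Pi.sub_apply, abs_mul]
    rw [abs_of_nonneg (h1 n x), abs_of_nonneg (by linarith [h2 n x] : 0 ≤ 1 - φ n x)]
    ring
  rw [integral_add_measure (isLipBdd_integrable_abs hd.1 _) (isLipBdd_integrable_abs hd.1 _)]
  refine ge_of_tendsto ((t1.add t2).const_mul _) (Eventually.of_forall fun n => ?_)
  have d2 : IsLipBdd (((fun _ => (1:ℝ)) - φ n) * f) := ((isLipBdd_const 1).sub (h0 n)).mul hd.1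
  have e : f = φ n * f + ((fun _ => (1:ℝ)) - φ n) * f := by ext x; simp; ring
  have e2 : T f π = T (φ n * f) π + T (((fun _ => (1:ℝ)) - φ n) * f) π := by
    conv_lhs => rw [e]
    exact hT.1 _ _ _ ((h0 n).mul hd.1) d2 hd.2
  rw [e2, mul_add]
  exact (abs_add_le _ _).trans (add_le_add (hμ _ _ ⟨(h0 n).mul hd.1, hd.2⟩) (hν _ _ ⟨d2, hd.2⟩))

/-- Combination along a measurable set. -/
lemma massBound_combine {T : Func X k} (hT : IsMultilinear T) {μ ν : Measure X}
    [IsFiniteMeasure μ] [IsFiniteMeasure ν] (hμ : MassBound T μ) (hν : MassBound T ν)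
    {A : Set X} (hA : MeasurableSet A) : MassBound T (μ.restrict A + ν.restrict Aᶜ) := by
  refine massBound_of_approx fun ε hε => ?_
  obtain ⟨F, hFA, hF, hlt⟩ := hA.exists_isClosed_sdiff_lt (measure_ne_top ν A) hε.ne'
  refine ⟨_, ν.restrict (A \ F), massBound_combine_closed hT hμ hν hF, ?_, ?_⟩
  · have e : Fᶜ = Aᶜ ∪ (A \ F) := by
      ext x; by_cases hx : x ∈ F <;> by_cases hy : x ∈ A <;> simp [hx, hy]
      exact hy (hFA hx)
    rw [add_assoc, e]
    exact add_le_add (Measure.restrict_mono hFA le_rfl) (Measure.restrict_union_le _ _)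
  · simpa using hlt.le

lemma massMeasure_cover {T : Func X k} {μ : Measure X} [IsFiniteMeasure μ] (hμ : MassBound T μ)
    {B : Set X} (hB : MeasurableSet B) (h0 : massMeasure T B = 0) (ε : ENNReal) (hε : 0 < ε) :
    ∃ (A : ℕ → Set X) (ν : ℕ → Measure X), B ⊆ ⋃ n, A n ∧ (∀ n, MeasurableSet (A n)) ∧
      (∀ n, IsFiniteMeasure (ν n)) ∧ (∀ n, MassBound T (ν n)) ∧ ∑' n, ν n (A n) ≤ ε := by
  unfold massMeasure at h0
  rw [Measure.sInf_apply hB, OuterMeasure.sInf_apply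
    (Set.Nonempty.image _ ⟨μ, by exact ⟨inferInstance, hμ⟩⟩)] at h0
  have hε2 : 0 < ε / 2 := ENNReal.half_pos hε.ne'
  have h1 := h0.trans_lt hε2
  simp only [iInf_lt_iff] at h1
  obtain ⟨t, ht, hlt⟩ := h1
  obtain ⟨δ, hδ, hsum⟩ := ENNReal.exists_pos_sum_of_countable hε2.ne' ℕ
  have hfin : ∀ n, (⨅ ν ∈ Measure.toOuterMeasure '' {μ : Measure X | IsFiniteMeasure μ ∧ MassBound T μ},
      ν (t n)) ≠ ⊤ := fun n => ne_top_of_lt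
    ((ENNReal.le_tsum (f := fun n => (⨅ ν ∈ Measure.toOuterMeasure '' {μ : Measure X | IsFiniteMeasure μ ∧ MassBound T μ},
      ν (t n))) n).trans_lt hlt)
  have h2 : ∀ n, ∃ ν : Measure X, (IsFiniteMeasure ν ∧ MassBound T ν) ∧ ν (t n) <
      (⨅ ν ∈ Measure.toOuterMeasure '' {μ : Measure X | IsFiniteMeasure μ ∧ MassBound T μ},
      ν (t n)) + δ n := by
    intro n
    have := ENNReal.lt_add_right (hfin n) (ENNReal.coe_ne_zero.2 (hδ n).ne')
    conv at this => lhs; rw [iInf_image]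
    simp only [iInf_lt_iff] at this
    obtain ⟨ν, hν, hlt⟩ := this
    exact ⟨ν, hν, hlt⟩
  choose ν hν hνt using h2
  refine ⟨fun n => toMeasurable (ν n) (t n), ν, ht.trans (iUnion_mono fun n => subset_toMeasurable _ _),
    fun n => measurableSet_toMeasurable _ _, fun n => (hν n).1, fun n => (hν n).2, ?_⟩
  simp only [measure_toMeasurable]
  calc ∑' n, ν n (t n) ≤ _ := ENNReal.tsum_le_tsum fun n => (hνt n).le
    _ = _ := ENNReal.tsum_add
    _ ≤ ε / 2 + ε / 2 := add_le_add hlt.le hsum.le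
    _ = ε := ENNReal.add_halves ε

lemma massBound_iter {T : Func X k} (hT : IsMultilinear T) {μ : Measure X} [IsFiniteMeasure μ]
    (hμ : MassBound T μ) (A : ℕ → Set X) (ν : ℕ → Measure X) (hA : ∀ n, MeasurableSet (A n))
    (hf : ∀ n, IsFiniteMeasure (ν n)) (hν : ∀ n, MassBound T (ν n)) (N : ℕ) :
    ∃ l : Measure X, IsFiniteMeasure l ∧ MassBound T l ∧
      l ≤ ∑ n ∈ Finset.range N, (ν n).restrict (A n) + μ.restrict (⋃ n ∈ Finset.range N, A n)ᶜ := by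
  induction N with
  | zero => exact ⟨μ, inferInstance, hμ, by simp⟩
  | succ N ih =>
    obtain ⟨l, hl, hlm, hle⟩ := ih
    refine ⟨(ν N).restrict (A N) + l.restrict (A N)ᶜ, inferInstance,
      massBound_combine hT (hν N) hlm (hA N), ?_⟩
    have h1 : l.restrict (A N)ᶜ ≤ ∑ n ∈ Finset.range N, (ν n).restrict (A n) +
        μ.restrict (⋃ n ∈ Finset.range (N+1), A n)ᶜ := by
      refine (Measure.restrict_mono le_rfl hle).trans ?_
      rw [Measure.restrict_add]
      refine add_le_add Measure.restrict_le_self ?_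
      rw [Measure.restrict_restrict (hA N).compl]
      refine Measure.restrict_mono ?_ le_rfl
      intro x hx
      simp only [mem_inter_iff, mem_compl_iff, mem_iUnion, Finset.mem_range, not_exists] at hx ⊢
      intro i hi
      rcases Nat.lt_succ_iff_lt_or_eq.1 hi with h | h
      · exact hx.2 i h
      · rw [h]; exact hx.1
    rw [Finset.sum_range_succ]
    calc _ ≤ (ν N).restrict (A N) + (∑ n ∈ Finset.range N, (ν n).restrict (A n) +
        μ.restrict (⋃ n ∈ Finset.range (N+1), A n)ᶜ) := add_le_add le_rfl h1
      _ = _ := by rw [← add_assoc, add_comm ((ν N).restrict (A N))]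

lemma massBound_restrict_of_null {T : Func X k} (hT : IsMultilinear T) {μ : Measure X}
    [IsFiniteMeasure μ] (hμ : MassBound T μ) {B : Set X} (hB : MeasurableSet B)
    (h0 : massMeasure T B = 0) : MassBound T (μ.restrict Bᶜ) := by
  refine massBound_of_approx fun ε hε => ?_
  have hε2 : 0 < ε / 2 := ENNReal.half_pos hε.ne'
  obtain ⟨A, ν, hBA, hA, hf, hν, hsum⟩ := massMeasure_cover hμ hB h0 _ hε2
  have hten : Tendsto (fun N => μ (B ∩ (⋃ n ∈ Finset.range N, A n)ᶜ)) atTop (nhds 0) := by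
    have this := tendsto_measure_iInter_atTop (μ := μ) (s := fun N => B ∩ (⋃ n ∈ Finset.range N, A n)ᶜ)
      (fun N => (hB.inter (Finset.measurableSet_biUnion _ fun n _ => hA n).compl).nullMeasurableSet)
      (fun N M h => inter_subset_inter_right _ (compl_subset_compl.2
        (biUnion_subset_biUnion_left fun i hi => Finset.mem_range.2
          ((Finset.mem_range.1 hi).trans_le h)))) ⟨0, measure_ne_top _ _⟩
    suffices e : (⋂ N : ℕ, B ∩ (⋃ n ∈ Finset.range N, A n)ᶜ) = ∅ by
      rw [e, measure_empty] at this
      exact this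
    rw [Set.eq_empty_iff_forall_notMem]
    intro x hx
    rw [mem_iInter] at hx
    obtain ⟨n, hn⟩ := mem_iUnion.1 (hBA (hx 0).1)
    exact (hx (n+1)).2 (mem_biUnion (Finset.mem_coe.2 (Finset.self_mem_range_succ n)) hn)
  obtain ⟨N, hN⟩ := (hten.eventually (gt_mem_nhds hε2)).exists
  obtain ⟨l, hl, hlm, hle⟩ := massBound_iter hT hμ A ν hA hf hν N
  set D := (⋃ n ∈ Finset.range N, A n)ᶜ with hD
  refine ⟨l, ∑ n ∈ Finset.range N, (ν n).restrict (A n) + μ.restrict (B ∩ D), hlm, ?_, ?_⟩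
  · refine hle.trans ?_
    rw [add_comm (μ.restrict Bᶜ), add_assoc]
    refine add_le_add le_rfl ?_
    refine (Measure.restrict_mono (?_ : D ⊆ (B ∩ D) ∪ Bᶜ) le_rfl).trans
      (Measure.restrict_union_le _ _)
    intro x hx
    by_cases h : x ∈ B
    · exact Or.inl ⟨h, hx⟩
    · exact Or.inr h
  · rw [Measure.add_apply, Measure.finsetSum_apply]
    simp only [Measure.restrict_apply_univ]
    calc _ ≤ ε / 2 + ε / 2 := add_le_add ((ENNReal.sum_le_tsum _).trans hsum) hN.le
      _ = ε := ENNReal.add_halves ε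

lemma msupport_isClosed (μ : Measure X) : IsClosed (msupport μ) := by
  rw [← isOpen_compl_iff, Metric.isOpen_iff]
  intro x hx
  simp only [msupport, mem_compl_iff, mem_ofPred_eq, not_forall, not_lt, exists_prop] at hx
  obtain ⟨r, hr, h0⟩ := hx
  refine ⟨r / 2, by positivity, fun y hy => ?_⟩
  simp only [msupport, mem_compl_iff, mem_ofPred_eq, not_forall, not_lt, exists_prop]
  refine ⟨r / 2, by positivity, (measure_mono ?_).trans h0⟩
  intro z hz
  rw [mem_ball] at *
  linarith [dist_triangle z y x]

lemma measure_msupport_compl {μ : Measure X} (ht : IsTightMeasure μ) : μ (msupport μ)ᶜ = 0 := by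
  refine le_antisymm (le_of_forall_pos_le_add fun ε hε => ?_) bot_le
  obtain ⟨C, hC, hlt⟩ := ht ε hε
  have h1 : μ ((msupport μ)ᶜ ∩ C) = 0 := by
    obtain ⟨F, hF, hFs, hFu, -⟩ := (msupport_isClosed μ).isOpen_compl.exists_iUnion_isClosed
    rw [← hFu, iUnion_inter, measure_iUnion_null_iff]
    intro n
    refine (hC.inter_left (hF n)).measure_zero_of_nhdsWithin fun x hx => ?_
    have := hFs n hx.1
    simp only [msupport, mem_compl_iff, mem_ofPred_eq, not_forall, not_lt, exists_prop] at this
    obtain ⟨r, hr, h0⟩ := this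
    exact ⟨ball x r, mem_nhdsWithin_of_mem_nhds (ball_mem_nhds x hr), le_antisymm h0 bot_le⟩
  calc μ (msupport μ)ᶜ ≤ μ (((msupport μ)ᶜ ∩ C) ∪ Cᶜ) := measure_mono fun x hx => by
        by_cases h : x ∈ C
        · exact Or.inl ⟨hx, h⟩
        · exact Or.inr h
    _ ≤ μ ((msupport μ)ᶜ ∩ C) + μ Cᶜ := measure_union_le _ _
    _ ≤ 0 + ε := add_le_add h1.le hlt.le

end Mass
end

open MeasureTheory Metric Set Filter
noncomputable section
set_option linter.unusedSectionVars false

section Good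
variable {X : Type*} [MetricSpace X] [MeasurableSpace X] [BorelSpace X] {k : ℕ}

/-- A normal current dominated by a finite measure carried by the compact set `K`. -/
structure Good (T : Func X k) (K : Set X) : Prop where
  cur : IsCurrent T
  nor : IsNormal T
  cpt : IsCompact K
  mass : ∃ ν : Measure X, IsFiniteMeasure ν ∧ ν Kᶜ = 0 ∧ MassBound T ν

lemma memNkc_of_good {T : Func X k} {K : Set X} (h : Good T K) : MemNkc T := by
  refine ⟨h.cur, h.nor, h.cpt.of_isClosed_subset (msupport_isClosed _) fun x hx => ?_⟩
  obtain ⟨ν, hf, h0, hν⟩ := h.mass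
  by_contra hxK
  obtain ⟨r, hr, hb⟩ := Metric.isOpen_iff.1 h.cpt.isClosed.isOpen_compl x hxK
  have hle : massMeasure T ≤ ν := sInf_le ⟨hf, hν⟩
  have := hx r hr
  have h2 : massMeasure T (ball x r) ≤ 0 := (hle _).trans ((measure_mono hb).trans h0.le)
  exact absurd this (not_lt.2 h2)

lemma good_of_memNkc {T : Func X k} (h : MemNkc T) : ∃ K, Good T K := by
  obtain ⟨hc, hn, hK⟩ := h
  refine ⟨_, hc, hn, hK, ?_⟩
  obtain ⟨μ, hf, ht, hμ⟩ := hc.2.1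
  have hle : massMeasure T ≤ μ := sInf_le ⟨hf, hμ⟩
  have ht' : IsTightMeasure (massMeasure T) := fun ε hε => by
    obtain ⟨C, hC, hlt⟩ := ht ε hε
    exact ⟨C, hC, (hle _).trans_lt hlt⟩
  have h0 := measure_msupport_compl ht'
  have hm := (msupport_isClosed (massMeasure T)).measurableSet
  refine ⟨_, inferInstance, ?_, massBound_restrict_of_null hc.1 hμ hm.compl h0⟩
  rw [compl_compl, Measure.restrict_apply hm.compl]
  simp

lemma MassBound.le_of_lip {T : Func X k} {ν : Measure X} (h : MassBound T ν) {f : X → ℝ}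
    {π : Fin k → X → ℝ} (hf : IsLipBdd f) {L : Fin k → NNReal}
    (hπ : ∀ i, LipschitzWith (L i) (π i)) :
    |T f π| ≤ (∏ i, (L i : ℝ)) * ∫ x, |f x| ∂ν := by
  refine (h f π ⟨hf, fun i => ⟨_, hπ i⟩⟩).trans ?_
  refine mul_le_mul_of_nonneg_right ?_ (integral_nonneg fun x => abs_nonneg _)
  exact Finset.prod_le_prod (fun _ _ => NNReal.coe_nonneg _) fun i _ =>
    NNReal.coe_le_coe.2 (lipConst_le (hπ i))

section Push
variable {Y : Type*} [MetricSpace Y] [MeasurableSpace Y] [BorelSpace Y]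

lemma massBound_push {T : Func X k} {ν : Measure X} (h : MassBound T ν) {φ : X → Y}
    (hφ : LipschitzWith 1 φ) : MassBound (pushF φ T) (ν.map φ) := by
  intro f π hd
  have h1 := h.le_of_lip (hd.1.comp hφ) (L := fun i => lipConst (π i)) (π := fun i => π i ∘ φ)
    (fun i => by simpa using (lipschitzWith_lipConst (hd.2 i)).comp hφ)
  refine h1.trans (le_of_eq ?_)
  congr 1
  rw [integral_map hφ.continuous.measurable.aemeasurable
    (hd.1.1.continuous.abs.aestronglyMeasurable)]
  rfl

lemma map_compl_image_le (ν : Measure X) {φ : X → Y} (hφ : LipschitzWith 1 φ) {K : Set X}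
    (hK : IsCompact K) : ν.map φ (φ '' K)ᶜ ≤ ν Kᶜ := by
  rw [Measure.map_apply hφ.continuous.measurable
    (hK.image hφ.continuous).isClosed.measurableSet.compl]
  refine measure_mono fun x hx hxK => hx ⟨x, hxK, rfl⟩

lemma hasFiniteMass_push {T : Func X k} (h : HasFiniteMass T) {φ : X → Y}
    (hφ : LipschitzWith 1 φ) : HasFiniteMass (pushF φ T) := by
  obtain ⟨μ, hf, ht, hμ⟩ := h
  refine ⟨μ.map φ, inferInstance, fun ε hε => ?_, massBound_push hμ hφ⟩
  obtain ⟨K, hK, hlt⟩ := ht ε hε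
  exact ⟨φ '' K, hK.image hφ.continuous, (map_compl_image_le μ hφ hK).trans_lt hlt⟩

lemma update_comp_push {φ : X → Y} (π : Fin k → Y → ℝ) (i : Fin k) (g : Y → ℝ) :
    (fun j => Function.update π i g j ∘ φ) = Function.update (fun j => π j ∘ φ) i (g ∘ φ) := by
  ext j x
  by_cases h : j = i
  · subst h; simp
  · simp [h]

lemma good_push {T : Func X k} {K : Set X} (h : Good T K) {φ : X → Y}
    (hφ : LipschitzWith 1 φ) : Good (pushF φ T) (φ '' K) := by
  obtain ⟨⟨hm, hmass, hloc, hcont⟩, hn, hK, ν, hf, h0, hν⟩ := h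
  refine ⟨⟨⟨?_, ?_, ?_, ?_⟩, hasFiniteMass_push hmass hφ, ?_, ?_⟩, ?_, hK.image hφ.continuous,
    ν.map φ, inferInstance, ?_, massBound_push hν hφ⟩
  · intro f g π hf hg hπ
    exact hm.1 _ _ _ (hf.comp hφ) (hg.comp hφ) fun i => (hπ i).comp hφ
  · intro c f π hf hπ
    exact hm.2.1 _ _ _ (hf.comp hφ) fun i => (hπ i).comp hφ
  · intro f π i g g' hf hπ hg hg'
    simp only [pushF, update_comp_push]
    exact hm.2.2.1 _ _ _ _ _ (hf.comp hφ) (fun i => (hπ i).comp hφ) (hg.comp hφ) (hg'.comp hφ)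
  · intro f π i c g hf hπ hg
    simp only [pushF, update_comp_push]
    exact hm.2.2.2 _ _ _ _ _ (hf.comp hφ) (fun i => (hπ i).comp hφ) (hg.comp hφ)
  · rintro f π hd ⟨i, hi⟩
    exact hloc _ _ ⟨hd.1.comp hφ, fun i => (hd.2 i).comp hφ⟩
      ⟨i, fun x hx x' hx' => hi _ hx _ hx'⟩
  · rintro f πs π hf ⟨L, hL⟩ hπ ht
    exact hcont _ _ _ (hf.comp hφ) ⟨L, fun j i => by simpa using (hL j i).comp hφ⟩
      (fun i => (hπ i).comp hφ) fun i x => ht i (φ x)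
  · cases k with
    | zero => trivial
    | succ k =>
      have e : bdry (pushF φ T) = pushF φ (bdry T) := by
        funext f π
        simp only [bdry, pushF]
        congr 1
        funext i
        refine Fin.cases ?_ (fun j => ?_) i <;> simp
      show HasFiniteMass (bdry (pushF φ T))
      rw [e]
      exact hasFiniteMass_push hn hφ
  · exact le_antisymm ((map_compl_image_le ν hφ hK).trans h0.le) bot_le

end Push

section WD
variable {T : Func X k} {K : Set X}

lemma wd_f (hm : IsMultilinear T) {ν : Measure X} (h0 : ν Kᶜ = 0) (hν : MassBound T ν)
    {f f' : X → ℝ} {π : Fin k → X → ℝ} (hf : IsLipBdd f) (hf' : IsLipBdd f')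
    (hπ : ∀ i, IsLip (π i)) (h : ∀ x ∈ K, f x = f' x) : T f π = T f' π := by
  have e : T f π = T f' π + T (f - f') π := by
    rw [← hm.1 _ _ _ hf' (hf.sub hf') hπ]
    congr 1
    ext x; simp
  have h1 := hν (f - f') π ⟨hf.sub hf', hπ⟩
  have h2 : ∫ x, |(f - f') x| ∂ν = 0 := by
    refine integral_eq_zero_of_ae ?_
    refine measure_mono_null (t := Kᶜ) (fun x hx hxK => hx ?_) h0
    simp [h x hxK]
  rw [h2, mul_zero] at h1
  rw [e, abs_nonpos_iff.1 h1, add_zero]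

lemma isLip_update {π : Fin k → X → ℝ} (hπ : ∀ i, IsLip (π i)) (i : Fin k) {g : X → ℝ}
    (hg : IsLip g) : ∀ j, IsLip (Function.update π i g j) := by
  intro j
  by_cases h : j = i
  · subst h; simpa using hg
  · simpa [h] using hπ j

lemma wd_zero (h : Good T K) {f g : X → ℝ} {π : Fin k → X → ℝ} (hf : IsLipBdd f)
    (hπ : ∀ i, IsLip (π i)) (hg : IsLip g) (i : Fin k) (hgK : ∀ x ∈ K, g x = 0) :
    T f (Function.update π i g) = 0 := by
  obtain ⟨⟨hm, hmass, hloc, hcont⟩, hn, hK, ν, hfin, h0, hν⟩ := h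
  have hε : ∀ n : ℕ, (0 : ℝ) < 1 / (n + 1) := fun n => Nat.one_div_pos_of_nat
  set G : ℕ → X → ℝ := fun n => g - fun x => clip (1 / (n + 1)) (g x) with hG
  have hGl : ∀ n, IsLip (G n) := fun n => hg.sub (hg.clip _)
  have z : ∀ n, T f (Function.update π i (G n)) = 0 := by
    intro n
    set φ : X → ℝ := fun x => 1 - clip 1 ((n + 1) * g x) * clip 1 ((n + 1) * g x) with hφ
    have hc : IsLipBdd (fun x => clip 1 ((n + 1) * g x)) :=
      (hg.smul ((n : ℝ) + 1)).clipBdd zero_le_one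
    have hφl : IsLipBdd φ := (isLipBdd_const 1).sub (hc.mul hc)
    rw [wd_f hm h0 hν hf (hφl.mul hf) (isLip_update hπ i (hGl n))]
    · refine hloc _ _ ⟨hφl.mul hf, isLip_update hπ i (hGl n)⟩ ⟨i, ?_⟩
      have : ∀ x, (φ * f) x ≠ 0 → G n x = 0 := by
        intro x hx
        simp only [hG, Pi.sub_apply]
        rw [clip_of_abs_le, sub_self]
        by_contra hlt
        push Not at hlt
        apply hx
        have hn : (0 : ℝ) < n + 1 := by positivity
        rw [div_lt_iff₀ hn] at hlt
        have : clip 1 ((n + 1) * g x) * clip 1 ((n + 1) * g x) = 1 := by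
          unfold clip
          rcases le_total 0 (g x) with hs | hs
          · rw [abs_of_nonneg hs] at hlt
            rw [min_eq_right (by linarith), max_eq_right (by norm_num)]; norm_num
          · rw [abs_of_nonpos hs] at hlt
            rw [min_eq_left (by linarith), max_eq_left (by linarith)]; norm_num
        simp only [hφ, Pi.mul_apply, this, sub_self, zero_mul]
      intro x hx x' hx'
      simp only [Function.update_self]
      rw [this x hx, this x' hx']
    · intro x hx
      simp [hφ, hgK x hx, clip]
  have ht : Tendsto (fun n => T f (Function.update π i (G n))) atTop
      (nhds (T f (Function.update π i g))) := by
    refine hcont f (fun n => Function.update π i (G n)) _ hf ?_ (isLip_update hπ i hg) ?_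
    · obtain ⟨L, hL⟩ := hg
      refine ⟨(2 * L) ⊔ Finset.univ.sup (fun j => lipConst (π j)), fun n j => ?_⟩
      by_cases hj : j = i
      · subst hj
        simp only [Function.update_self]
        refine LipschitzWith.weaken (K := 2 * L) ?_ le_sup_left
        refine LipschitzWith.of_dist_le_mul fun x y => ?_
        have h1 := hL.dist_le_mul x y
        have h2 := clip_lip (1 / (n + 1)) (g x) (g y)
        rw [Real.dist_eq] at *
        have e : G n x - G n y = (g x - g y) - (clip (1 / (n + 1)) (g x) - clip (1 / (n + 1)) (g y)) := by
          simp only [hG, Pi.sub_apply]; ring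
        rw [e]
        refine (abs_sub _ _).trans ?_
        push_cast
        linarith
      · rw [Function.update_of_ne hj]
        exact (lipschitzWith_lipConst (hπ j)).weaken
          (le_sup_of_le_right (Finset.le_sup (f := fun j => lipConst (π j)) (Finset.mem_univ j)))
    · intro j x
      by_cases hj : j = i
      · subst hj
        simp only [Function.update_self]
        have : Tendsto (fun n : ℕ => clip (1 / (n + 1)) (g x)) atTop (nhds 0) := by
          refine squeeze_zero_norm (fun n => ?_) tendsto_one_div_add_atTop_nhds_zero_nat
          exact clip_abs_le (hε n).le _
        simpa [hG] using this.const_sub (g x)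
      · simp only [Function.update_of_ne hj]
        exact tendsto_const_nhds
  simp only [z] at ht
  exact (tendsto_nhds_unique ht tendsto_const_nhds)

lemma wd_step (h : Good T K) {f g g' : X → ℝ} {π : Fin k → X → ℝ} (hf : IsLipBdd f)
    (hπ : ∀ i, IsLip (π i)) (hg : IsLip g) (hg' : IsLip g') (i : Fin k)
    (hgK : ∀ x ∈ K, g x = g' x) :
    T f (Function.update π i g) = T f (Function.update π i g') := by
  have e : g = g' + (g - g') := by ext x; simp
  have := h.cur.1.2.2.1 f π i g' (g - g') hf hπ hg' (hg.sub hg')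
  rw [← e] at this
  rw [this, wd_zero h hf hπ (hg.sub hg') i fun x hx => by simp [hgK x hx], add_zero]

lemma wd (h : Good T K) {f f' : X → ℝ} {π π' : Fin k → X → ℝ} (hd : InDomain f π)
    (hd' : InDomain f' π') (hf : ∀ x ∈ K, f x = f' x) (hπ : ∀ i, ∀ x ∈ K, π i x = π' i x) :
    T f π = T f' π' := by
  have key : ∀ s : Finset (Fin k), T f π = T f (s.piecewise π' π) := by
    classical
    intro s
    induction s using Finset.induction_on with
    | empty => simp
    | insert i s hi ih =>
      rw [ih, Finset.piecewise_insert]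
      have hl : ∀ j, IsLip (s.piecewise π' π j) := by
        intro j
        by_cases hj : j ∈ s
        · simpa [hj] using hd'.2 j
        · simpa [hj] using hd.2 j
      have := wd_step h (f := f) hd.1 hl (hd.2 i) (hd'.2 i) i (hπ i)
      rw [← this]
      congr 1
      ext j
      by_cases hj : j = i
      · subst hj; simp [hi]
      · simp [hj]
  rw [key Finset.univ, Finset.piecewise_univ]
  obtain ⟨ν, hfin, h0, hν⟩ := h.mass
  exact wd_f h.cur.1 h0 hν hd.1 hd'.1 hd'.2 hf

end WD
end Good
end

open MeasureTheory Metric Set Filter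
noncomputable section
set_option linter.unusedSectionVars false

section Leibniz
variable {X : Type*} [MetricSpace X] [MeasurableSpace X] [BorelSpace X] {k : ℕ}

lemma isLip_cons {g : X → ℝ} {π : Fin k → X → ℝ} (hg : IsLip g) (hπ : ∀ i, IsLip (π i)) :
    ∀ i, IsLip ((Fin.cons g π : Fin (k+1) → X → ℝ) i) := by
  intro i
  refine Fin.cases ?_ (fun j => ?_) i
  · simpa using hg
  · simpa using hπ j

variable {T : Func X (k+1)}

lemma cons_add_eq (hm : IsMultilinear T) {h g g' : X → ℝ} {π : Fin k → X → ℝ} (hh : IsLipBdd h)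
    (hg : IsLip g) (hg' : IsLip g') (hπ : ∀ i, IsLip (π i)) :
    T h (Fin.cons (g + g') π) = T h (Fin.cons g π) + T h (Fin.cons g' π) := by
  have := hm.2.2.1 h (Fin.cons g π) 0 g g' hh (isLip_cons hg hπ) hg hg'
  simpa only [Fin.update_cons_zero] using this

lemma cons_smul_eq (hm : IsMultilinear T) {h g : X → ℝ} {π : Fin k → X → ℝ} (c : ℝ)
    (hh : IsLipBdd h) (hg : IsLip g) (hπ : ∀ i, IsLip (π i)) :
    T h (Fin.cons (c • g) π) = c * T h (Fin.cons g π) := by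
  have := hm.2.2.2 h (Fin.cons g π) 0 c g hh (isLip_cons hg hπ) hg
  simpa only [Fin.update_cons_zero] using this

lemma cons_bound {ν : Measure X} (hν : MassBound T ν) {h g : X → ℝ} {π : Fin k → X → ℝ}
    (hh : IsLipBdd h) {L : NNReal} (hg : LipschitzWith L g) (hπ : ∀ i, IsLip (π i)) :
    |T h (Fin.cons g π)| ≤ (L * ∏ i, (lipConst (π i) : ℝ)) * ∫ x, |h x| ∂ν := by
  have := hν.le_of_lip (f := h) (π := Fin.cons g π) hh
    (L := Fin.cons L (fun i => lipConst (π i))) (fun i => by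
      refine Fin.cases ?_ (fun j => ?_) i
      · simpa using hg
      · simpa using lipschitzWith_lipConst (hπ j))
  simpa [Fin.prod_univ_succ] using this

lemma sq_local (hm : IsMultilinear T) (hloc : SatisfiesLocality T) {ν : Measure X}
    [IsFiniteMeasure ν] (hν : MassBound T ν) {h f : X → ℝ} {π : Fin k → X → ℝ} (hh : IsLipBdd h)
    (hf : IsLipBdd f) {L : NNReal} (hL : LipschitzWith L f) (hπ : ∀ i, IsLip (π i)) (a : ℝ)
    (ε : NNReal) (hsup : ∀ x, h x ≠ 0 → |f x - a| ≤ ε) :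
    |T h (Fin.cons (f * f) π) - 2 * T (h * f) (Fin.cons f π)| ≤
      (4 * L * ∏ i, (lipConst (π i) : ℝ)) * ε * ∫ x, |h x| ∂ν := by
  set P := ∏ i, (lipConst (π i) : ℝ) with hP
  have hP0 : 0 ≤ P := lipProd_nonneg π
  have hfa : IsLipBdd (f - fun _ => a) := hf.sub (isLipBdd_const a)
  set c : X → ℝ := fun x => clip ε (f x - a) with hc
  have hcl : IsLipBdd c := hfa.1.clipBdd ε.2
  have hccL : LipschitzWith (2 * ε * L) (c * c) := by
    refine LipschitzWith.of_dist_le_mul fun x y => ?_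
    have h1 : |c x - c y| ≤ L * dist x y := by
      have := hL.dist_le_mul x y
      rw [Real.dist_eq] at this
      refine (clip_lip _ _ _).trans ?_
      simpa using this
    have h2 : |c x + c y| ≤ 2 * ε := by
      refine (abs_add_le _ _).trans ?_
      have hx : |c x| ≤ ε := clip_abs_le (NNReal.coe_nonneg ε) _
      have hy : |c y| ≤ ε := clip_abs_le (NNReal.coe_nonneg ε) _
      linarith
    have e : (c * c) x - (c * c) y = (c x + c y) * (c x - c y) := by
      simp only [Pi.mul_apply]; ring
    rw [Real.dist_eq, e, abs_mul]
    push_cast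
    calc _ ≤ (2 * ε : ℝ) * (L * dist x y) := mul_le_mul h2 h1 (abs_nonneg _) (by positivity)
      _ = _ := by ring
  have hff := hf.mul hf
  have hcc := hcl.mul hcl
  have h2f : IsLip ((2 * a) • f) := hf.1.smul _
  set r : X → ℝ := f * f - ((2 * a) • f + c * c) with hr
  have hrl : IsLip r := hff.1.sub (h2f.add hcc.1)
  have e1 : f * f = ((2 * a) • f + c * c) + r := by rw [hr]; ring
  have hr0 : T h (Fin.cons r π) = 0 := by
    refine hloc _ _ ⟨hh, isLip_cons hrl hπ⟩ ⟨0, ?_⟩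
    have : ∀ x, h x ≠ 0 → r x = - a ^ 2 := by
      intro x hx
      have : c x = f x - a := clip_of_abs_le (hsup x hx)
      simp only [hr, Pi.sub_apply, Pi.add_apply, Pi.mul_apply, Pi.smul_apply, smul_eq_mul, this]
      ring
    intro x hx x' hx'
    simp only [Fin.cons_zero]
    rw [this x hx, this x' hx']
  have e2 : T h (Fin.cons (f * f) π) = 2 * a * T h (Fin.cons f π) + T h (Fin.cons (c * c) π) := by
    rw [e1, cons_add_eq hm hh (h2f.add hcc.1) hrl hπ, hr0, cons_add_eq hm hh h2f hcc.1 hπ,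
      cons_smul_eq hm _ hh hf.1 hπ, add_zero]
  have e3 : T (h * f) (Fin.cons f π) = T (h * (f - fun _ => a)) (Fin.cons f π)
      + a * T h (Fin.cons f π) := by
    rw [← hm.2.1 a _ _ hh (isLip_cons hf.1 hπ), ← hm.1 _ _ _ (hh.mul hfa) (hh.smul a)
      (isLip_cons hf.1 hπ)]
    congr 1
    ext x
    simp only [Pi.sub_apply, Pi.add_apply, Pi.mul_apply, Pi.smul_apply, smul_eq_mul]
    ring
  have b1 := cons_bound hν hh hccL hπ
  have b2 := cons_bound hν (hh.mul hfa) hL hπ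
  have b3 : ∫ x, |(h * (f - fun _ : X => a) : X → ℝ) x| ∂ν ≤ ε * ∫ x, |h x| ∂ν := by
    rw [← integral_const_mul]
    refine integral_mono (isLipBdd_integrable_abs (hh.mul hfa) ν)
      ((isLipBdd_integrable_abs hh ν).const_mul _) fun x => ?_
    simp only [Pi.mul_apply, Pi.sub_apply, abs_mul]
    by_cases hx : h x = 0
    · simp [hx]
    · rw [mul_comm]
      exact mul_le_mul_of_nonneg_right (hsup x hx) (abs_nonneg _)
  have b4 := b2.trans (mul_le_mul_of_nonneg_left b3 (by positivity))
  have e4 : T h (Fin.cons (f * f) π) - 2 * T (h * f) (Fin.cons f π) =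
      T h (Fin.cons (c * c) π) - 2 * T (h * (f - fun _ => a)) (Fin.cons f π) := by
    rw [e2, e3]; ring
  rw [e4]
  refine (abs_sub _ _).trans ?_
  rw [abs_mul, abs_two]
  push_cast at b1
  nlinarith [b1, b4]

lemma isLipBdd_theta {f : X → ℝ} (hf : IsLip f) (b c : ℝ) :
    IsLipBdd (fun x => max 0 (min 1 (f x * b + c))) := by
  obtain ⟨C, hC⟩ := isLip_iff.1 hf
  refine ⟨isLip_iff.2 ⟨|b| * C, fun x y => ?_⟩, 1, fun x => ?_⟩
  · have h1 : |max 0 (min 1 (f x * b + c)) - max 0 (min 1 (f y * b + c))| ≤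
        |min 1 (f x * b + c) - min 1 (f y * b + c)| := by
      rw [max_comm 0, max_comm 0]
      exact abs_max_sub_max_le_abs _ _ _
    have h2 : |min 1 (f x * b + c) - min 1 (f y * b + c)| ≤ |(f x * b + c) - (f y * b + c)| :=
      (abs_min_sub_min_le_max _ _ _ _).trans (by simp)
    refine h1.trans (h2.trans ?_)
    have e : (f x * b + c) - (f y * b + c) = b * (f x - f y) := by ring
    rw [e, abs_mul, mul_assoc]
    exact mul_le_mul_of_nonneg_left (hC x y) (abs_nonneg _)
  · rw [abs_of_nonneg (le_max_left _ _)]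
    exact max_le zero_le_one (min_le_left _ _)

lemma sq_rule (hm : IsMultilinear T) (hloc : SatisfiesLocality T) {ν : Measure X}
    [IsFiniteMeasure ν] (hν : MassBound T ν) {h f : X → ℝ} {π : Fin k → X → ℝ} (hh : IsLipBdd h)
    (hf : IsLipBdd f) (hπ : ∀ i, IsLip (π i)) :
    T h (Fin.cons (f * f) π) = 2 * T (h * f) (Fin.cons f π) := by
  obtain ⟨L, hL⟩ := hf.1
  obtain ⟨M, hM⟩ := hf.2
  have hff := hf.mul hf
  set D := (4 * L * ∏ i, (lipConst (π i) : ℝ)) with hD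
  have hD0 : 0 ≤ D := mul_nonneg (by positivity) (lipProd_nonneg π)
  set I := ∫ x, |h x| ∂ν with hI
  have hI0 : 0 ≤ I := integral_nonneg fun x => abs_nonneg _
  set E : (X → ℝ) → ℝ := fun u => T u (Fin.cons (f * f) π) - 2 * T (u * f) (Fin.cons f π) with hE
  have hEadd : ∀ u v, IsLipBdd u → IsLipBdd v → E (u + v) = E u + E v := by
    intro u v hu hv
    simp only [hE]
    rw [hm.1 u v _ hu hv (isLip_cons hff.1 hπ), add_mul,
      hm.1 _ _ _ (hu.mul hf) (hv.mul hf) (isLip_cons hf.1 hπ)]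
    ring
  have key : ∀ ε : NNReal, 0 < ε → |E h| ≤ D * ε * I := by
    intro ε hε
    have hε' : (0 : ℝ) < ε := hε
    set θ : ℕ → X → ℝ := fun j x => max 0 (min 1 (f x * (ε : ℝ)⁻¹ + (M / ε + 1 - j))) with hθ
    have hθl : ∀ j, IsLipBdd (θ j) := fun j => isLipBdd_theta hf.1 _ _
    have hanti : ∀ j x, θ (j+1) x ≤ θ j x := by
      intro j x
      simp only [hθ]
      push_cast
      gcongr
      linarith
    have hloc1 : ∀ j x, θ j x - θ (j+1) x ≠ 0 → |f x - (ε * j - M)| ≤ ε := by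
      intro j x hx
      set t := f x * (ε : ℝ)⁻¹ + (M / ε + 1) with ht
      have htf : f x = ε * (t - 1) - M := by
        rw [ht]; field_simp; ring
      have e1 : θ j x = max 0 (min 1 (t - j)) := by simp only [hθ, ht]; ring_nf
      have e2 : θ (j+1) x = max 0 (min 1 (t - j - 1)) := by
        simp only [hθ, ht]; push_cast; ring_nf
      rw [e1, e2] at hx
      have h1 : 0 < t - j := by
        by_contra hc
        push Not at hc
        apply hx
        rw [max_eq_left ((min_le_right _ _).trans hc),
          max_eq_left ((min_le_right _ _).trans (by linarith)), sub_self]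
      have h2 : t - j - 1 < 1 := by
        by_contra hc
        push Not at hc
        apply hx
        rw [min_eq_left hc, min_eq_left (by linarith), sub_self]
      have e3 : f x - (ε * j - M) = ε * (t - j - 1) := by rw [htf]; ring
      rw [e3, abs_mul, abs_of_pos hε']
      have : |t - j - 1| ≤ 1 := by rw [abs_le]; constructor <;> linarith
      nlinarith
    have hE1 : ∀ j, |E (θ j * h) - E (θ (j+1) * h)| ≤
        D * ε * (∫ x, |(θ j * h) x| ∂ν - ∫ x, |(θ (j+1) * h) x| ∂ν) := by
      intro j
      have hd : IsLipBdd ((θ j - θ (j+1)) * h) := ((hθl j).sub (hθl (j+1))).mul hh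
      have e1 : E (θ j * h) - E (θ (j+1) * h) = E ((θ j - θ (j+1)) * h) := by
        have := hEadd _ _ hd ((hθl (j+1)).mul hh)
        rw [← add_mul, sub_add_cancel] at this
        rw [this]; ring
      rw [e1]
      refine (sq_local hm hloc hν hd hf hL hπ (ε * j - M) ε ?_).trans (le_of_eq ?_)
      · intro x hx
        refine hloc1 j x fun h0 => hx ?_
        simp only [Pi.mul_apply, Pi.sub_apply, h0, zero_mul]
      · congr 1
        rw [← integral_sub (isLipBdd_integrable_abs ((hθl j).mul hh) ν)
          (isLipBdd_integrable_abs ((hθl (j+1)).mul hh) ν)]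
        refine integral_congr_ae (Eventually.of_forall fun x => ?_)
        simp only [Pi.mul_apply, Pi.sub_apply, abs_mul]
        rw [abs_of_nonneg (by linarith [hanti j x] : 0 ≤ θ j x - θ (j+1) x),
          abs_of_nonneg (le_max_left _ _ : 0 ≤ θ j x),
          abs_of_nonneg (le_max_left _ _ : 0 ≤ θ (j+1) x)]
        ring
    obtain ⟨N, hN⟩ := exists_nat_ge (2 * M / ε + 1)
    have hθ0 : θ 0 * h = h := by
      ext x
      have : 0 ≤ f x * (ε : ℝ)⁻¹ + M / ε := by
        have h1 := (abs_le.1 (hM x)).1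
        have : f x * (ε : ℝ)⁻¹ + M / ε = (f x + M) / ε := by field_simp
        rw [this]
        exact div_nonneg (by linarith) hε'.le
      simp only [hθ, Pi.mul_apply]
      rw [min_eq_left (by push_cast; linarith), max_eq_right zero_le_one, one_mul]
    have hθN : θ N * h = 0 := by
      ext x
      have : f x * (ε : ℝ)⁻¹ + (M / ε + 1) ≤ 2 * M / ε + 1 := by
        have h1 := (abs_le.1 (hM x)).2
        have : f x * (ε : ℝ)⁻¹ ≤ M / ε := by
          rw [div_eq_mul_inv]; gcongr
        have e : 2 * M / ε = M / ε + M / ε := by ring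
        linarith
      simp only [hθ, Pi.mul_apply, Pi.zero_apply]
      rw [min_eq_right (by linarith [hε'] : _ ≤ (1:ℝ)), max_eq_left (by linarith), zero_mul]
    have hE0 : E 0 = 0 := by
      have h00 : IsLipBdd (0 : X → ℝ) := isLipBdd_const 0
      have := hEadd 0 0 h00 h00
      rw [add_zero] at this
      linarith
    have hs1 := Finset.sum_range_sub' (fun j => E (θ j * h)) N
    have hs2 := Finset.sum_range_sub' (fun j => ∫ x, |(θ j * h) x| ∂ν) N
    simp only [hθ0, hθN, hE0, sub_zero] at hs1 hs2
    rw [← hs1]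
    refine (Finset.abs_sum_le_sum_abs _ _).trans ?_
    refine (Finset.sum_le_sum fun j _ => hE1 j).trans ?_
    rw [← Finset.mul_sum, hs2]
    simp [hI]
  have hz : |E h| ≤ 0 := by
    refine le_of_forall_pos_le_add fun ε hε => ?_
    have hDI : 0 ≤ D * I := mul_nonneg hD0 hI0
    have hp : 0 < ε / (D * I + 1) := div_pos hε (by linarith)
    have := key (Real.toNNReal (ε / (D * I + 1))) (Real.toNNReal_pos.2 hp)
    refine this.trans ?_
    rw [zero_add, Real.coe_toNNReal _ hp.le]
    have e : D * (ε / (D * I + 1)) * I = (D * I * ε) / (D * I + 1) := by ring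
    rw [e, div_le_iff₀ (by positivity)]
    nlinarith
  have := abs_nonpos_iff.1 hz
  simp only [hE] at this
  linarith

lemma leibniz (hm : IsMultilinear T) (hloc : SatisfiesLocality T) {ν : Measure X}
    [IsFiniteMeasure ν] (hν : MassBound T ν) {g f : X → ℝ} {π : Fin k → X → ℝ} (hg : IsLipBdd g)
    (hf : IsLipBdd f) (hπ : ∀ i, IsLip (π i)) :
    T (fun _ => 1) (Fin.cons (g * f) π) = T g (Fin.cons f π) + T f (Fin.cons g π) := by
  have h1 : IsLipBdd (fun _ : X => (1:ℝ)) := isLipBdd_const 1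
  have hgf := hg.mul hf
  have one : ∀ u : X → ℝ, (fun _ : X => (1:ℝ)) * u = u := fun u => by ext x; simp
  have s1 := sq_rule hm hloc hν h1 (hg.add hf) hπ
  have s2 := sq_rule hm hloc hν h1 hg hπ
  have s3 := sq_rule hm hloc hν h1 hf hπ
  rw [one] at s1 s2 s3
  have e : (g + f) * (g + f) = (g * g + f * f) + (2:ℝ) • (g * f) := by
    ext x; simp; ring
  rw [e, cons_add_eq hm h1 ((hg.mul hg).add (hf.mul hf)).1 (hgf.smul 2).1 hπ,
    cons_add_eq hm h1 (hg.mul hg).1 (hf.mul hf).1 hπ, cons_smul_eq hm _ h1 hgf.1 hπ,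
    s2, s3, cons_add_eq hm (hg.add hf) hg.1 hf.1 hπ,
    hm.1 _ _ _ hg hf (isLip_cons hg.1 hπ), hm.1 _ _ _ hg hf (isLip_cons hf.1 hπ)] at s1
  linarith

end Leibniz

section Cut
variable {X : Type*} [MetricSpace X] [MeasurableSpace X] [BorelSpace X]

lemma IsTightMeasure.add' {μ ν : Measure X} (hμ : IsTightMeasure μ) (hν : IsTightMeasure ν) :
    IsTightMeasure (μ + ν) := by
  intro ε hε
  obtain ⟨K, hK, h1⟩ := hμ (ε / 2) (ENNReal.half_pos hε.ne')
  obtain ⟨K', hK', h2⟩ := hν (ε / 2) (ENNReal.half_pos hε.ne')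
  refine ⟨K ∪ K', hK.union hK', ?_⟩
  rw [Measure.add_apply]
  calc _ ≤ μ Kᶜ + ν K'ᶜ := add_le_add (measure_mono (compl_subset_compl.2 subset_union_left))
          (measure_mono (compl_subset_compl.2 subset_union_right))
    _ < ε / 2 + ε / 2 := ENNReal.add_lt_add h1 h2
    _ = ε := ENNReal.add_halves ε

lemma tight_of_compact {μ : Measure X} {K : Set X} (hK : IsCompact K) (h : μ Kᶜ = 0) :
    IsTightMeasure μ := fun ε hε => ⟨K, hK, by rwa [h]⟩

lemma good_cut {k : ℕ} {T : Func X k} {K F : Set X} (h : Good T K) {φ : X → ℝ}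
    (hφ : IsLipBdd φ) (hφ1 : ∀ x, |φ x| ≤ 1) (hF : IsClosed F) (hφF : ∀ x ∉ F, φ x = 0) :
    Good (fun f π => T (φ * f) π) (K ∩ F) := by
  obtain ⟨⟨hm, hmass, hloc, hcont⟩, hn, hK, ν, hf, h0, hν⟩ := h
  have hKF : IsCompact (K ∩ F) := hK.inter_right hF
  have hν0 : (ν.restrict F) (K ∩ F)ᶜ = 0 := by
    rw [Measure.restrict_apply hKF.isClosed.measurableSet.compl]
    refine measure_mono_null (t := Kᶜ) (fun x hx hxK => hx.1 ⟨hxK, hx.2⟩) h0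
  have hbound : MassBound (fun f π => T (φ * f) π) (ν.restrict F) := by
    intro f π hd
    refine (hν _ _ ⟨hφ.mul hd.1, hd.2⟩).trans ?_
    refine mul_le_mul_of_nonneg_left ?_ (lipProd_nonneg π)
    rw [← integral_indicator hF.measurableSet]
    refine integral_mono (isLipBdd_integrable_abs (hφ.mul hd.1) ν)
      ((isLipBdd_integrable_abs hd.1 ν).indicator hF.measurableSet) fun x => ?_
    by_cases hx : x ∈ F
    · simp only [hx, indicator_of_mem, Pi.mul_apply, abs_mul]
      exact mul_le_of_le_one_left (abs_nonneg _) (hφ1 x)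
    · simp [hx, hφF x hx]
  refine ⟨⟨⟨?_, ?_, ?_, ?_⟩, ⟨_, inferInstance, tight_of_compact hKF hν0, hbound⟩, ?_, ?_⟩, ?_,
    hKF, _, inferInstance, hν0, hbound⟩
  · intro f g π hf hg hπ
    simp only [mul_add]
    exact hm.1 _ _ _ (hφ.mul hf) (hφ.mul hg) hπ
  · intro c f π hf hπ
    simp only [mul_smul_comm]
    exact hm.2.1 _ _ _ (hφ.mul hf) hπ
  · intro f π i g g' hf hπ hg hg'
    exact hm.2.2.1 _ _ _ _ _ (hφ.mul hf) hπ hg hg'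
  · intro f π i c g hf hπ hg
    exact hm.2.2.2 _ _ _ _ _ (hφ.mul hf) hπ hg
  · rintro f π hd ⟨i, hi⟩
    refine hloc _ _ ⟨hφ.mul hd.1, hd.2⟩ ⟨i, fun x hx x' hx' => hi x ?_ x' ?_⟩
    · exact right_ne_zero_of_mul hx
    · exact right_ne_zero_of_mul hx'
  · intro f πs π hf hL hπ ht
    exact hcont _ _ _ (hφ.mul hf) hL hπ ht
  · cases k with
    | zero => trivial
    | succ k =>
      obtain ⟨μ, hμf, hμt, hμ⟩ := hn
      obtain ⟨L, hL⟩ := hφ.1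
      have hLν : (L • ν) Kᶜ = 0 := by simp [h0]
      refine ⟨μ + L • ν, inferInstance, hμt.add' (tight_of_compact hK hLν), ?_⟩
      intro f π hd
      have e1 : φ * (fun _ : X => (1:ℝ)) = φ := by ext x; simp
      have e2 : bdry (fun f π => T (φ * f) π) f π = bdry T (φ * f) π - T f (Fin.cons φ π) := by
        simp only [bdry, e1]
        rw [leibniz hm hloc hν hφ hd.1 hd.2]; ring
      rw [e2]
      have b1 := hμ _ _ ⟨hφ.mul hd.1, hd.2⟩
      have b2 := cons_bound hν hd.1 hL hd.2
      have hP := lipProd_nonneg π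
      have b3 : ∫ x, |(φ * f) x| ∂μ ≤ ∫ x, |f x| ∂μ := by
        refine integral_mono (isLipBdd_integrable_abs (hφ.mul hd.1) μ)
          (isLipBdd_integrable_abs hd.1 μ) fun x => ?_
        simp only [Pi.mul_apply, abs_mul]
        exact mul_le_of_le_one_left (abs_nonneg _) (hφ1 x)
      rw [integral_add_measure (isLipBdd_integrable_abs hd.1 _) (isLipBdd_integrable_abs hd.1 _),
        integral_smul_nnreal_measure, NNReal.smul_def, smul_eq_mul, mul_add]
      refine (abs_sub _ _).trans (add_le_add
        (b1.trans (mul_le_mul_of_nonneg_left b3 hP)) (b2.trans (le_of_eq (by ring))))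

end Cut
end

open MeasureTheory Metric Set Filter
noncomputable section
set_option linter.unusedSectionVars false

section Lift
variable {X : Type*} [MetricSpace X]

lemma exists_extL {W : Set X} {g : W → ℝ} {L : NNReal} (hg : LipschitzWith L g) :
    ∃ G : X → ℝ, LipschitzWith L G ∧ ∀ w : W, G w = g w := by
  classical
  set g0 : X → ℝ := fun x => if h : x ∈ W then g ⟨x, h⟩ else 0 with hg0
  have e : ∀ w : W, g0 w = g w := fun w => by simp [hg0]
  have hl : LipschitzOnWith L g0 W := by
    refine LipschitzOnWith.of_dist_le_mul fun x hx y hy => ?_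
    have := hg.dist_le_mul ⟨x, hx⟩ ⟨y, hy⟩
    rw [← e, ← e] at this
    exact this
  obtain ⟨G, hG, hGe⟩ := hl.extend_real
  exact ⟨G, hG, fun w => by rw [← hGe w.2, e]⟩

lemma exists_extB {W : Set X} {g : W → ℝ} (hg : IsLipBdd g) :
    ∃ G : X → ℝ, IsLipBdd G ∧ ∀ w : W, G w = g w := by
  obtain ⟨⟨L, hL⟩, C, hC⟩ := hg
  obtain ⟨G, hG, hGe⟩ := exists_extL hL
  refine ⟨fun x => clip |C| (G x), IsLip.clipBdd ⟨L, hG⟩ (abs_nonneg C), fun w => ?_⟩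
  simp only
  rw [clip_of_abs_le, hGe]
  rw [hGe]
  exact (hC w).trans (le_abs_self C)

open Classical in
/-- A chosen Lipschitz extension with the same Lipschitz constant. -/
def extL {W : Set X} (g : W → ℝ) : X → ℝ :=
  if h : IsLip g then (exists_extL (lipschitzWith_lipConst h)).choose else 0

open Classical in
/-- A chosen bounded Lipschitz extension. -/
def extB {W : Set X} (g : W → ℝ) : X → ℝ :=
  if h : IsLipBdd g then (exists_extB h).choose else 0

lemma extL_lip {W : Set X} {g : W → ℝ} (h : IsLip g) : LipschitzWith (lipConst g) (extL g) := by
  rw [extL, dif_pos h]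
  exact (exists_extL (lipschitzWith_lipConst h)).choose_spec.1

lemma extL_eq {W : Set X} {g : W → ℝ} (h : IsLip g) (w : W) : extL g w = g w := by
  rw [extL, dif_pos h]
  exact (exists_extL (lipschitzWith_lipConst h)).choose_spec.2 w

lemma extL_eq' {W : Set X} {g : W → ℝ} (h : IsLip g) {x : X} (hx : x ∈ W) :
    extL g x = g ⟨x, hx⟩ := extL_eq h ⟨x, hx⟩

lemma extL_isLip {W : Set X} {g : W → ℝ} (h : IsLip g) : IsLip (extL g) := ⟨_, extL_lip h⟩

lemma extB_isLipBdd {W : Set X} {g : W → ℝ} (h : IsLipBdd g) : IsLipBdd (extB g) := by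
  rw [extB, dif_pos h]
  exact (exists_extB h).choose_spec.1

lemma extB_eq {W : Set X} {g : W → ℝ} (h : IsLipBdd g) (w : W) : extB g w = g w := by
  rw [extB, dif_pos h]
  exact (exists_extB h).choose_spec.2 w

lemma extB_eq' {W : Set X} {g : W → ℝ} (h : IsLipBdd g) {x : X} (hx : x ∈ W) :
    extB g x = g ⟨x, hx⟩ := extB_eq h ⟨x, hx⟩

lemma unif_of_lip {K : Set X} (hK : IsCompact K) {g : ℕ → X → ℝ} {g0 : X → ℝ} {L : NNReal}
    (hg : ∀ j, LipschitzWith L (g j)) (hg0 : LipschitzWith L g0)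
    (ht : ∀ x ∈ K, Tendsto (fun j => g j x) atTop (nhds (g0 x))) {ε : ℝ} (hε : 0 < ε) :
    ∀ᶠ j in atTop, ∀ x ∈ K, |g j x - g0 x| ≤ ε := by
  have hr : 0 < ε / (4 * (L + 1) : ℝ) := by positivity
  obtain ⟨t, htK, htf, hcov⟩ := hK.finite_cover_balls hr
  have h1 : ∀ᶠ j in atTop, ∀ y ∈ t, |g j y - g0 y| < ε / 2 := by
    rw [Filter.eventually_all_finite htf]
    intro y hy
    have := (Metric.tendsto_nhds.1 (ht y (htK hy))) (ε / 2) (half_pos hε)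
    simpa [Real.dist_eq] using this
  filter_upwards [h1] with j hj x hx
  obtain ⟨y, hy, hxy⟩ := mem_iUnion₂.1 (hcov hx)
  rw [mem_ball] at hxy
  have a1 := (hg j).dist_le_mul x y
  have a2 := hg0.dist_le_mul x y
  rw [Real.dist_eq] at a1 a2
  have a3 := hj y hy
  have a4 : (L : ℝ) * dist x y ≤ ε / 4 := by
    calc (L : ℝ) * dist x y ≤ (L + 1) * (ε / (4 * (L + 1) : ℝ)) := by
          refine mul_le_mul (by linarith) hxy.le dist_nonneg (by positivity)
      _ = ε / 4 := by field_simp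
  have := a1.trans a4
  have a5 := a2.trans a4
  rw [abs_le] at *
  rw [abs_lt] at a3
  constructor <;> linarith [this.1, this.2, a5.1, a5.2, a3.1, a3.2]

/-- modify a pointwise-on-`K` convergent sequence off `K` to converge everywhere. -/
lemma exists_good_seq {K : Set X} (hK : IsCompact K) {g : ℕ → X → ℝ} {g0 : X → ℝ} {L : NNReal}
    (hg : ∀ j, LipschitzWith L (g j)) (hg0 : LipschitzWith L g0)
    (ht : ∀ x ∈ K, Tendsto (fun j => g j x) atTop (nhds (g0 x))) :
    ∃ G : ℕ → X → ℝ, (∀ j, LipschitzWith L (G j)) ∧ (∀ j, ∀ x ∈ K, G j x = g j x) ∧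
      ∀ x, Tendsto (fun j => G j x) atTop (nhds (g0 x)) := by
  set d : ℕ → ℝ := fun j => sSup ((fun x => |g j x - g0 x|) '' K) with hd
  have hd0 : ∀ j, 0 ≤ d j := fun j => Real.sSup_nonneg (by rintro _ ⟨x, -, rfl⟩; exact abs_nonneg _)
  have hdx : ∀ j, ∀ x ∈ K, |g j x - g0 x| ≤ d j := fun j x hx =>
    le_csSup (hK.bddAbove_image ((hg j).continuous.sub hg0.continuous).abs.continuousOn) ⟨x, hx, rfl⟩
  have hdt : Tendsto d atTop (nhds 0) := by
    rw [Metric.tendsto_nhds]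
    intro ε hε
    filter_upwards [unif_of_lip hK hg hg0 ht (half_pos hε)] with j hj
    rw [Real.dist_eq, sub_zero, abs_of_nonneg (hd0 j)]
    refine (Real.sSup_le ?_ (half_pos hε).le).trans_lt (half_lt_self hε)
    rintro _ ⟨x, hx, rfl⟩
    exact hj x hx
  refine ⟨fun j x => max (g0 x - d j) (min (g j x) (g0 x + d j)), fun j => ?_, fun j x hx => ?_,
    fun x => ?_⟩
  · have h1 : LipschitzWith L (fun x => g0 x - d j) := by
      simpa using hg0.sub (LipschitzWith.const (α := X) (d j))
    have h2 : LipschitzWith L (fun x => g0 x + d j) := by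
      simpa using hg0.add (LipschitzWith.const (α := X) (d j))
    simpa using h1.max ((hg j).min h2)
  · have := abs_le.1 (hdx j x hx)
    simp only
    rw [min_eq_left (by linarith), max_eq_right (by linarith)]
  · have t1 : Tendsto (fun j => g0 x - d j) atTop (nhds (g0 x)) := by
      simpa using (tendsto_const_nhds (x := g0 x)).sub hdt
    have t2 : Tendsto (fun j => g0 x + d j) atTop (nhds (g0 x)) := by
      simpa using (tendsto_const_nhds (x := g0 x)).add hdt
    refine tendsto_of_tendsto_of_tendsto_of_le_of_le t1 t2 (fun j => le_max_left _ _) fun j => ?_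
    exact max_le (by linarith [hd0 j]) (min_le_right _ _)

lemma exists_cut_in {K W : Set X} (hK : IsCompact K) (hW : IsOpen W) (hKW : K ⊆ W) :
    ∃ φ : X → ℝ, IsLipBdd φ ∧ (∀ x ∈ K, φ x = 1) ∧ ∀ x ∉ W, φ x = 0 := by
  obtain ⟨δ, hδ, hs⟩ := hK.exists_thickening_subset_open hW hKW
  refine ⟨fun x => (thickenedIndicator hδ K x : ℝ), ⟨⟨δ.toNNReal⁻¹, ?_⟩, 1, fun x => ?_⟩,
    fun x hx => ?_, fun x hx => ?_⟩
  · exact lipschitzWith_thickenedIndicator hδ K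
  · rw [abs_of_nonneg (NNReal.coe_nonneg _)]
    exact_mod_cast thickenedIndicator_le_one hδ K x
  · have := thickenedIndicator_one hδ K hx
    simp only
    exact_mod_cast this
  · have := thickenedIndicator_zero hδ K (fun h => hx (hs h))
    simp only
    exact_mod_cast this

variable [MeasurableSpace X] [BorelSpace X]

lemma massBound_lift {m : ℕ} {P : Func X m} {W K : Set X} (hW : IsOpen W) (hK : IsCompact K)
    (hKW : K ⊆ W) {ν : Measure X} [IsFiniteMeasure ν] (h0 : ν Kᶜ = 0) (hν : MassBound P ν)
    {P' : Func W m} (hP : ∀ f π, InDomain f π → P' f π = P (extB f) (fun i => extL (π i))) :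
    ∃ ν' : Measure W, IsFiniteMeasure ν' ∧ IsCompact ((Subtype.val : W → X) ⁻¹' K) ∧
      ν' ((Subtype.val : W → X) ⁻¹' K)ᶜ = 0 ∧ MassBound P' ν' := by
  have hWm := hW.measurableSet
  have hWe := MeasurableEmbedding.subtype_coe hWm
  refine ⟨ν.comap Subtype.val, ⟨?_⟩, ?_, ?_, ?_⟩
  · rw [hWe.comap_apply]; exact measure_lt_top _ _
  · rw [Topology.IsInducing.subtypeVal.isCompact_preimage_iff]
    · exact hK
    · simpa using hKW
  · rw [hWe.comap_apply]
    refine measure_mono_null ?_ h0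
    rintro _ ⟨w, hw, rfl⟩
    exact hw
  · intro f π hd
    rw [hP f π hd]
    refine (hν.le_of_lip (extB_isLipBdd hd.1) (fun i => extL_lip (hd.2 i))).trans (le_of_eq ?_)
    congr 1
    have e : ∀ w : W, |f w| = |extB f w| := fun w => by rw [extB_eq hd.1]
    simp only [e]
    rw [integral_subtype_comap hWm (fun x => |extB f x|), Measure.restrict_eq_self_of_ae_mem]
    refine measure_mono_null (fun x hx => ?_) h0
    exact fun hxK => hx (hKW hxK)

lemma bdry_mass {k : ℕ} {T : Func X (k+1)} {K : Set X} (h : Good T K) :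
    ∃ μ : Measure X, IsFiniteMeasure μ ∧ μ Kᶜ = 0 ∧ MassBound (bdry T) μ := by
  obtain ⟨μ, hf, ht, hμ⟩ : HasFiniteMass (bdry T) := h.nor
  have hKc := h.cpt.isClosed
  refine ⟨μ.restrict K, inferInstance, ?_, ?_⟩
  · rw [Measure.restrict_apply hKc.measurableSet.compl]; simp
  · intro f π hd
    obtain ⟨φ, h0, h1, h2, h3, h4⟩ := exists_lip_approx K hKc
    have t := (tendsto_integral_approx hKc h0 h1 h2 h4 hd.1 μ).const_mul
      (∏ i, (lipConst (π i) : ℝ))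
    refine ge_of_tendsto t (Eventually.of_forall fun n => ?_)
    have e : bdry T f π = bdry T (φ n * f) π := by
      refine wd h ⟨isLipBdd_const 1, isLip_cons hd.1.1 hd.2⟩
        ⟨isLipBdd_const 1, isLip_cons ((h0 n).mul hd.1).1 hd.2⟩ (fun _ _ => rfl) fun i => ?_
      refine Fin.cases ?_ (fun j => ?_) i
      · intro x hx; simp [h3 n x hx]
      · intro x hx; simp
    rw [e]
    exact hμ _ _ ⟨(h0 n).mul hd.1, hd.2⟩

lemma inNkcOf_of_good {k : ℕ} {T : Func X k} {K W : Set X} (h : Good T K) (hW : IsOpen W)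
    (hKW : K ⊆ W) : InNkcOf W T := by
  have hh := h
  obtain ⟨⟨hm, hmass, hloc, hcont⟩, hn, hK, ν, hf, h0, hν⟩ := h
  set T' : Func W k := fun f π => T (extB f) (fun i => extL (π i)) with hT'
  have dom : ∀ {f : W → ℝ} {π : Fin k → W → ℝ}, InDomain f π →
      InDomain (extB f) (fun i => extL (π i)) := fun hd =>
    ⟨extB_isLipBdd hd.1, fun i => extL_isLip (hd.2 i)⟩
  have hup : ∀ (π : Fin k → W → ℝ) (i : Fin k) (g : W → ℝ),
      (fun j => extL (Function.update π i g j)) = Function.update (fun j => extL (π j)) i (extL g) := by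
    intro π i g
    funext j
    by_cases hj : j = i
    · subst hj; simp
    · simp [hj]
  obtain ⟨ν', hf', hK', h0', hν'⟩ := massBound_lift hW hK hKW h0 hν (P' := T') (fun _ _ _ => rfl)
  have hgood : Good T' ((Subtype.val : W → X) ⁻¹' K) := by
    refine ⟨⟨⟨?_, ?_, ?_, ?_⟩, ⟨ν', hf', tight_of_compact hK' h0', hν'⟩, ?_, ?_⟩, ?_, hK', ν', hf',
      h0', hν'⟩
    · intro f g π hf hg hπ
      have hF := extB_isLipBdd hf
      have hG := extB_isLipBdd hg
      have hP := fun i => extL_isLip (hπ i)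
      simp only [hT']
      rw [← hm.1 _ _ _ hF hG hP]
      refine wd_f hm h0 hν (extB_isLipBdd (hf.add hg)) (hF.add hG) hP fun x hx => ?_
      rw [Pi.add_apply, extB_eq' (hf.add hg) (hKW hx), extB_eq' hf (hKW hx), extB_eq' hg (hKW hx),
        Pi.add_apply]
    · intro c f π hf hπ
      have hF := extB_isLipBdd hf
      have hP := fun i => extL_isLip (hπ i)
      simp only [hT']
      rw [← hm.2.1 _ _ _ hF hP]
      refine wd_f hm h0 hν (extB_isLipBdd (hf.smul c)) (hF.smul c) hP fun x hx => ?_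
      rw [Pi.smul_apply, extB_eq' (hf.smul c) (hKW hx), extB_eq' hf (hKW hx), Pi.smul_apply]
    · intro f π i g g' hf hπ hg hg'
      have hF := extB_isLipBdd hf
      have hP := fun i => extL_isLip (hπ i)
      have hG := extL_isLip hg
      have hG' := extL_isLip hg'
      simp only [hT', hup]
      rw [← hm.2.2.1 _ _ _ _ _ hF hP hG hG']
      refine wd_step hh hF hP (extL_isLip (hg.add hg')) (hG.add hG') i fun x hx => ?_
      rw [Pi.add_apply, extL_eq' (hg.add hg') (hKW hx), extL_eq' hg (hKW hx),
        extL_eq' hg' (hKW hx), Pi.add_apply]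
    · intro f π i c g hf hπ hg
      have hF := extB_isLipBdd hf
      have hP := fun i => extL_isLip (hπ i)
      have hG := extL_isLip hg
      simp only [hT', hup]
      rw [← hm.2.2.2 _ _ _ _ _ hF hP hG]
      refine wd_step hh hF hP (extL_isLip (hg.smul c)) (hG.smul c) i fun x hx => ?_
      rw [Pi.smul_apply, extL_eq' (hg.smul c) (hKW hx), extL_eq' hg (hKW hx), Pi.smul_apply]
    · rintro f π hd ⟨i, hi⟩
      obtain ⟨φ, hφ, hφ1, hφ0⟩ := exists_cut_in hK hW hKW
      have hD := dom hd
      have e : T' f π = T (φ * extB f) (fun i => extL (π i)) :=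
        wd_f hm h0 hν hD.1 (hφ.mul hD.1) hD.2 fun x hx => by simp [hφ1 x hx]
      rw [e]
      refine hloc _ _ ⟨hφ.mul hD.1, hD.2⟩ ⟨i, ?_⟩
      have key : ∀ x, (φ * extB f) x ≠ 0 → ∃ hx : x ∈ W, f ⟨x, hx⟩ ≠ 0 := by
        intro x hx
        have hxW : x ∈ W := by
          by_contra hn
          exact hx (by simp [hφ0 x hn])
        refine ⟨hxW, ?_⟩
        rw [← extB_eq' hd.1 hxW]
        exact right_ne_zero_of_mul hx
      intro x hx x' hx'
      obtain ⟨hxW, h1⟩ := key x hx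
      obtain ⟨hxW', h1'⟩ := key x' hx'
      rw [extL_eq' (hd.2 i) hxW, extL_eq' (hd.2 i) hxW']
      exact hi _ h1 _ h1'
    · rintro f πs π hf ⟨L, hL⟩ hπ ht
      set C : NNReal := max L (Finset.univ.sup fun i => lipConst (π i)) with hC
      have c1 : ∀ j i, LipschitzWith C (extL (πs j i)) := fun j i =>
        (extL_lip ⟨L, hL j i⟩).weaken ((lipConst_le (hL j i)).trans (le_max_left _ _))
      have c2 : ∀ i, LipschitzWith C (extL (π i)) := fun i =>
        (extL_lip (hπ i)).weaken ((Finset.le_sup (f := fun i => lipConst (π i))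
          (Finset.mem_univ i)).trans (le_max_right _ _))
      have hex := fun i => exists_good_seq hK (fun j => c1 j i) (c2 i) (fun x hx => by
        rw [extL_eq' (hπ i) (hKW hx)]
        have := ht i ⟨x, hKW hx⟩
        refine this.congr fun j => ?_
        rw [extL_eq' ⟨L, hL j i⟩ (hKW hx)])
      choose G g1 g2 g3 using hex
      have hF := extB_isLipBdd hf
      have := hcont (extB f) (fun j i => G i j) (fun i => extL (π i)) hF ⟨C, fun j i => g1 i j⟩
        (fun i => ⟨C, c2 i⟩) g3
      refine this.congr fun j => ?_
      exact wd hh ⟨hF, fun i => ⟨C, g1 i j⟩⟩ ⟨hF, fun i => ⟨C, c1 j i⟩⟩ (fun _ _ => rfl)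
        fun i x hx => g2 i j x hx
    · cases k with
      | zero => trivial
      | succ k =>
        obtain ⟨μ, hμf, hμ0, hμ⟩ := bdry_mass hh
        obtain ⟨μ', hμf', -, hμ0', hμ'⟩ := massBound_lift hW hK hKW hμ0 hμ (P' := bdry T') (by
          intro f π hd
          have hD1 : InDomain (fun _ : W => (1:ℝ)) (Fin.cons f π : Fin (k+1) → W → ℝ) := by
            refine ⟨isLipBdd_const 1, fun i => ?_⟩
            refine Fin.cases ?_ (fun j => ?_) i
            · simpa using hd.1.1
            · simpa using hd.2 j
          refine wd hh (dom hD1) ⟨isLipBdd_const 1, isLip_cons (extB_isLipBdd hd.1).1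
            fun i => extL_isLip (hd.2 i)⟩ (fun x hx => ?_) fun i => ?_
          · rw [extB_eq' (isLipBdd_const 1) (hKW hx)]
          · refine Fin.cases ?_ (fun j => ?_) i
            · intro x hx
              simp only [Fin.cons_zero]
              rw [extB_eq' hd.1 (hKW hx), extL_eq' hd.1.1 (hKW hx)]
            · intro x hx
              simp only [Fin.cons_succ])
        exact ⟨μ', hμf', tight_of_compact hK' hμ0', hμ'⟩
  refine ⟨T', memNkc_of_good hgood, fun f π hd => ?_⟩
  have hv : LipschitzWith 1 (Subtype.val : W → X) := LipschitzWith.subtype_val W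
  have hd' : InDomain (f ∘ (Subtype.val : W → X)) (fun i => π i ∘ (Subtype.val : W → X)) :=
    ⟨hd.1.comp hv, fun i => (hd.2 i).comp hv⟩
  refine wd hh (dom hd') hd (fun x hx => ?_) fun i x hx => ?_
  · rw [extB_eq' hd'.1 (hKW hx)]; rfl
  · rw [extL_eq' (hd'.2 i) (hKW hx)]; rfl

lemma InNkcOf.congr {k : ℕ} {T T₂ : Func X k} {W : Set X} (h : InNkcOf W T) (he : DkEq T T₂) :
    InNkcOf W T₂ := by
  obtain ⟨T', h1, h2⟩ := h
  exact ⟨T', h1, fun f π hd => (h2 f π hd).trans (he f π hd)⟩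

lemma InNkcOf.exists_good {k : ℕ} {T : Func X k} {W : Set X} (h : InNkcOf W T) :
    ∃ P K, Good P K ∧ K ⊆ W ∧ DkEq P T := by
  obtain ⟨T', h1, h2⟩ := h
  obtain ⟨K', hK'⟩ := good_of_memNkc h1
  refine ⟨_, _, good_push hK' (LipschitzWith.subtype_val W), ?_, h2⟩
  rintro _ ⟨w, -, rfl⟩
  exact w.2

lemma InNkcOf.mono {k : ℕ} {T : Func X k} {W W' : Set X} (h : InNkcOf W T) (hW : IsOpen W')
    (hs : W ⊆ W') : InNkcOf W' T := by
  obtain ⟨P, K, hP, hK, he⟩ := h.exists_good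
  exact (inNkcOf_of_good hP hW (hK.trans hs)).congr he

lemma exists_cut {K U V : Set X} (hK : IsCompact K) (hU : IsOpen U) (hV : IsOpen V)
    (hs : K ⊆ U ∪ V) : ∃ (φ : X → ℝ) (F G : Set X), IsLipBdd φ ∧ (∀ x, 0 ≤ φ x) ∧ (∀ x, φ x ≤ 1) ∧
      IsClosed F ∧ IsClosed G ∧ (∀ x ∉ F, φ x = 0) ∧ (∀ x ∉ G, φ x = 1) ∧ K ∩ F ⊆ U ∧
      K ∩ G ⊆ V := by
  rcases (K \ V).eq_empty_or_nonempty with hA | hA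
  · refine ⟨fun _ => 0, ∅, univ, isLipBdd_const 0, fun _ => le_rfl, fun _ => zero_le_one,
      isClosed_empty, isClosed_univ, fun _ _ => rfl, fun x hx => absurd (mem_univ x) hx, by simp, ?_⟩
    rw [inter_univ]
    exact sdiff_eq_empty.1 hA
  · have hAc : IsCompact (K \ V) := hK.diff hV
    have hAU : K \ V ⊆ U := fun x hx => (hs hx.1).resolve_right hx.2
    obtain ⟨δ, hδ, hsub⟩ := hAc.exists_thickening_subset_open hU hAU
    set u : X → ℝ := fun x => infDist x (K \ V) with hu
    have hul : IsLip u := ⟨1, lipschitz_infDist_pt _⟩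
    refine ⟨fun x => max 0 (min 1 (u x * (-(4 / δ)) + 2)), {x | u x ≤ δ / 2}, {x | δ / 4 ≤ u x},
      isLipBdd_theta hul _ _, fun x => le_max_left _ _, fun x => max_le zero_le_one (min_le_left _ _),
      isClosed_le hul.continuous continuous_const, isClosed_le continuous_const hul.continuous,
      fun x hx => ?_, fun x hx => ?_, ?_, ?_⟩
    · have hx' : δ / 2 < u x := not_le.1 hx
      have : 2 ≤ u x * (4 / δ) := by
        rw [mul_div_assoc', le_div_iff₀ hδ]; linarith
      apply max_eq_left
      exact (min_le_right _ _).trans (by linarith)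
    · have hx' : u x < δ / 4 := not_le.1 hx
      have : u x * (4 / δ) ≤ 1 := by
        rw [mul_div_assoc', div_le_iff₀ hδ]; linarith
      simp only
      rw [min_eq_left (by linarith), max_eq_right zero_le_one]
    · rintro x ⟨-, hx⟩
      refine hsub ((mem_thickening_iff_infDist_lt hA).2 ?_)
      have : u x ≤ δ / 2 := hx
      linarith [hu]
    · rintro x ⟨hxK, hx⟩
      by_contra hxV
      have h0 : u x = 0 := infDist_zero_of_mem ⟨hxK, hxV⟩
      have : δ / 4 ≤ u x := hx
      linarith

end Lift
end

/-- Mayer–Vietoris exactness for normal currents with compact support: for open `U, V ⊆ X`,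
identifying each `N_k^c(W)` with its image in `N_k^c(X)`, the sequence
`0 → N_k^c(U ∩ V) → N_k^c(U) ⊕ N_k^c(V) → N_k^c(U ∪ V) → 0` is exact, where the first map is
`T ↦ (-T, T)` and the second is `(S, S') ↦ S + S'`. -/
theorem nkc_mayer_vietoris_exact {X : Type*} [MetricSpace X] [MeasurableSpace X] [BorelSpace X]
    {k : ℕ} (U V : Set X) (hU : IsOpen U) (hV : IsOpen V) :
    -- the identifications are compatible, so the maps are well defined
    (∀ T : Func X k, InNkcOf (U ∩ V) T → InNkcOf U T ∧ InNkcOf V T) ∧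
    (∀ S : Func X k, InNkcOf U S ∨ InNkcOf V S → InNkcOf (U ∪ V) S) ∧
    -- exactness at `N_k^c(U ∩ V)`: the map `T ↦ (-T, T)` is injective
    (∀ T T₂ : Func X k, InNkcOf (U ∩ V) T → InNkcOf (U ∩ V) T₂ →
      DkEq (-T) (-T₂) ∧ DkEq T T₂ → DkEq T T₂) ∧
    -- the composition of the two maps vanishes
    (∀ T : Func X k, InNkcOf (U ∩ V) T → DkEq ((-T) + T) 0) ∧
    -- exactness in the middle: the kernel of `(S, S') ↦ S + S'` lies in the image of
    -- `T ↦ (-T, T)`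
    (∀ S S' : Func X k, InNkcOf U S → InNkcOf V S' → DkEq (S + S') 0 →
      ∃ T : Func X k, InNkcOf (U ∩ V) T ∧ DkEq S (-T) ∧ DkEq S' T) ∧
    -- exactness at `N_k^c(U ∪ V)`: the sum map is surjective
    (∀ T : Func X k, InNkcOf (U ∪ V) T →
      ∃ S S' : Func X k, InNkcOf U S ∧ InNkcOf V S' ∧ DkEq T (S + S')) := by
  refine ⟨fun T h => ⟨h.mono hU inter_subset_left, h.mono hV inter_subset_right⟩, ?_,
    fun _ _ _ _ h => h.2, ?_, ?_, ?_⟩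
  · rintro S (h | h)
    · exact h.mono (hU.union hV) subset_union_left
    · exact h.mono (hU.union hV) subset_union_right
  · intro T _ f π _
    simp
  · intro S S' hS hS' hz
    have hz' : ∀ f π, InDomain f π → S f π + S' f π = 0 := fun f π hd => by
      simpa using hz f π hd
    refine ⟨S', ?_, fun f π hd => ?_, fun _ _ _ => rfl⟩
    · obtain ⟨P₁, K₁, h₁, hK₁, e₁⟩ := hS.exists_good
      obtain ⟨P₂, K₂, h₂, hK₂, e₂⟩ := hS'.exists_good
      obtain ⟨ν₁, hf₁, h0₁, hν₁⟩ := h₁.mass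
      obtain ⟨ν₂, hf₂, h0₂, hν₂⟩ := h₂.mass
      have hν : MassBound P₂ ν₁ := by
        intro f π hd
        have : P₂ f π = - P₁ f π := by
          rw [e₁ f π hd, e₂ f π hd]
          linarith [hz' f π hd]
        rw [this, abs_neg]
        exact hν₁ f π hd
      have hK₁m := h₁.cpt.isClosed.measurableSet
      have hc : IsCompact (K₁ ∩ K₂) := h₁.cpt.inter h₂.cpt
      have hcm := hc.isClosed.measurableSet
      have hg : Good P₂ (K₁ ∩ K₂) := by
        refine ⟨h₂.cur, h₂.nor, hc, _, inferInstance, ?_,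
          massBound_combine h₂.cur.1 hν₂ hν hK₁m⟩
        rw [Measure.add_apply, Measure.restrict_apply hcm.compl, Measure.restrict_apply hcm.compl,
          add_eq_zero]
        constructor
        · exact measure_mono_null (t := K₂ᶜ) (fun x hx hx2 => hx.1 ⟨hx.2, hx2⟩) h0₂
        · exact measure_mono_null (t := K₁ᶜ) (fun x hx => hx.2) h0₁
      exact (inNkcOf_of_good hg (hU.inter hV) (inter_subset_inter hK₁ hK₂)).congr e₂
    · have := hz' f π hd
      simp only [Pi.neg_apply]
      linarith
  · intro T hT
    obtain ⟨P, K, hP, hK, e⟩ := hT.exists_good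
    obtain ⟨φ, F, G, hφ, hφ0, hφ1, hF, hG, hφF, hφG, hKF, hKG⟩ := exists_cut hP.cpt hU hV hK
    have h1 : IsLipBdd ((fun _ => 1) - φ) := (isLipBdd_const 1).sub hφ
    have g1 := good_cut hP hφ (fun x => abs_le.2 ⟨by linarith [hφ0 x], hφ1 x⟩) hF hφF
    have g2 := good_cut hP h1 (fun x => by
      simp only [Pi.sub_apply]
      exact abs_le.2 ⟨by linarith [hφ1 x], by linarith [hφ0 x]⟩) hG
      (fun x hx => by simp [hφG x hx])
    refine ⟨_, _, inNkcOf_of_good g1 hU hKF, inNkcOf_of_good g2 hV hKG, fun f π hd => ?_⟩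
    simp only [Pi.add_apply]
    rw [← e f π hd, ← hP.cur.1.1 _ _ _ (hφ.mul hd.1) (h1.mul hd.1) hd.2]
    congr 1
    ext x
    simp only [Pi.add_apply, Pi.mul_apply, Pi.sub_apply]
    ring
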